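/- arXiv:1903.04085 — 9 statements merged into one kernel-verified Lean document; each statement's English description precedes it below -/
import Mathlib

section
/- Let d ≤ N, let A ∈ ℝ^{d×N} have full row rank d, let C ∈ ℝ^{N×N}, and let R₀ ∈ ℝ^{d×N} satisfy R₀ᵀA − AᵀR₀ = C. Then a matrix X ∈ ℝ^{d×N} satisfies XᵀA − AᵀX = C if and only if X = W A + R₀ for some symmetric matrix W ∈ ℝ^{d×d}. -/
open Matrix

/-- Lemma A.1 in the paper. Let `d ≤ N`, let `A ∈ ℝ^{d×N}` have full row
rank `d`, let `C ∈ ℝ^{N×N}`, and let `R₀ ∈ ℝ^{d×N}` satisfy `R₀ᵀA − AᵀR₀ = C`. Then a matrix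
`X ∈ ℝ^{d×N}` satisfies `XᵀA − AᵀX = C` if and only if `X = W A + R₀` for some symmetric
`W ∈ ℝ^{d×d}`. -/
theorem stmt0 {d N : ℕ} (hdN : d ≤ N)
    (A : Matrix (Fin d) (Fin N) ℝ) (hA : A.rank = d)
    (C : Matrix (Fin N) (Fin N) ℝ)
    (R0 : Matrix (Fin d) (Fin N) ℝ) (hR0 : R0ᵀ * A - Aᵀ * R0 = C)
    (X : Matrix (Fin d) (Fin N) ℝ) :
    Xᵀ * A - Aᵀ * X = C ↔
      ∃ W : Matrix (Fin d) (Fin d) ℝ, W.IsSymm ∧ X = W * A + R0 := by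
  have hsurj : Function.Surjective A.mulVec := by
    have h : LinearMap.range A.mulVecLin = ⊤ := by
      apply Submodule.eq_top_of_finrank_eq
      have h2 : Module.finrank ℝ (LinearMap.range A.mulVecLin) = d := hA
      rw [h2]
      simp
    exact LinearMap.range_eq_top.mp h
  obtain ⟨B, hB⟩ := mulVec_surjective_iff_exists_right_inverse.mp hsurj
  have hB2 : Bᵀ * Aᵀ = 1 := by rw [← transpose_mul, hB, transpose_one]
  constructor
  · intro hX
    have hY : (X - R0)ᵀ * A = Aᵀ * (X - R0) := by
      have h : Xᵀ * A - Aᵀ * X - (R0ᵀ * A - Aᵀ * R0) = 0 := by rw [hX, hR0, sub_self]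
      rw [← sub_eq_zero, ← h, transpose_sub, Matrix.sub_mul, Matrix.mul_sub]
      abel
    have h1 : Bᵀ * (X - R0)ᵀ * A = X - R0 := by
      rw [Matrix.mul_assoc, hY, ← Matrix.mul_assoc, hB2, Matrix.one_mul]
    refine ⟨Bᵀ * (X - R0)ᵀ, ?_, ?_⟩
    · have h2 : Bᵀ * (X - R0)ᵀ = (X - R0) * B := by
        conv_rhs => rw [← h1]
        rw [Matrix.mul_assoc _ A B, hB, Matrix.mul_one]
      unfold Matrix.IsSymm
      rw [transpose_mul, transpose_transpose, transpose_transpose, h2]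
    · rw [h1, sub_add_cancel]
  · rintro ⟨W, hW, rfl⟩
    rw [← hR0, transpose_add, transpose_mul, hW.eq, Matrix.add_mul, Matrix.mul_add,
      Matrix.mul_assoc]
    abel
end

section
/- Every G ∈ 𝒢 admits a spectral factor X(t) = Σ_{p=0}^{P} A_p t^p with A_p ∈ ℂ^{d×N} such that G(t) = X(t)ᴴ X(t) for all t ∈ ℝ, the constant coefficient A₀ is real, and A₀ ∈ 𝒳₀. -/
open Matrix Finset

/-- `M ∈ 𝒳₀`: the rows of `M` are pairwise orthogonal and nonzero, and the first nonzero
entry in each row of `M` is positive. -/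
def memX0 {d N : ℕ} (M : Matrix (Fin d) (Fin N) ℝ) : Prop :=
  (∀ i i' : Fin d, i ≠ i' → M i ⬝ᵥ M i' = 0) ∧
  (∀ i : Fin d, ∃ j : Fin N, 0 < M i j ∧ ∀ k : Fin N, k < j → M i k = 0)

/-- Evaluation at `t ∈ ℝ` of the complex polynomial matrix with coefficients `A_0, …, A_P`. -/
noncomputable def polyEvalC {d N : ℕ} (P : ℕ) (A : ℕ → Matrix (Fin d) (Fin N) ℂ) (t : ℝ) :
    Matrix (Fin d) (Fin N) ℂ :=
  ∑ p ∈ Finset.range (P + 1), (t : ℂ) ^ p • A p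

open Polynomial ComplexOrder

noncomputable instance polyStarRing : StarRing ℂ[X] where
  star p := p.map (starRingEnd ℂ)
  star_involutive p := by
    ext n; simp
  star_mul p q := by
    simp [Polynomial.map_mul, mul_comm]
  star_add p q := by simp

theorem poly_star_def (p : ℂ[X]) : star p = p.map (starRingEnd ℂ) := rfl

theorem eval_star_poly (p : ℂ[X]) (z : ℂ) :
    (star p).eval z = star (p.eval (star z)) := by
  have h := Polynomial.hom_eval₂ p (RingHom.id ℂ) (starRingEnd ℂ) (star z)
  rw [poly_star_def, Polynomial.eval_map]
  simp only [Polynomial.eval] at *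
  rw [← starRingEnd_apply, h]
  simp

theorem coeff_star_poly (p : ℂ[X]) (n : ℕ) : (star p).coeff n = star (p.coeff n) := by
  simp [poly_star_def]

theorem star_X_sub_C (a : ℂ) : star (X - C a : ℂ[X]) = X - C (star a) := by
  simp [poly_star_def]

theorem star_C_poly (a : ℂ) : star (C a : ℂ[X]) = C (star a) := by
  simp [poly_star_def]

/-- evaluation of a polynomial matrix -/
noncomputable def pev {m n : Type*} (z : ℂ) (A : Matrix m n ℂ[X]) : Matrix m n ℂ :=
  A.map (fun p => p.eval z)

theorem pev_apply {m n : Type*} (z : ℂ) (A : Matrix m n ℂ[X]) (i j) :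
    pev z A i j = (A i j).eval z := rfl

theorem pev_mul {m n o : Type*} [Fintype n] (z : ℂ) (A : Matrix m n ℂ[X]) (B : Matrix n o ℂ[X]) :
    pev z (A * B) = pev z A * pev z B := by
  ext i j
  simp [pev, Matrix.mul_apply, Polynomial.eval_finsetSum]

theorem pev_star {m n : Type*} (z : ℂ) (A : Matrix m n ℂ[X]) :
    pev z Aᴴ = (pev (star z) A)ᴴ := by
  ext i j
  simp only [pev, Matrix.conjTranspose_apply, Matrix.map_apply, eval_star_poly]

theorem pev_add {m n : Type*} (z : ℂ) (A B : Matrix m n ℂ[X]) :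
    pev z (A + B) = pev z A + pev z B := by
  ext i j; simp [pev]

theorem pev_sub {m n : Type*} (z : ℂ) (A B : Matrix m n ℂ[X]) :
    pev z (A - B) = pev z A - pev z B := by
  ext i j; simp [pev]

theorem pev_smul {m n : Type*} (z : ℂ) (p : ℂ[X]) (A : Matrix m n ℂ[X]) :
    pev z (p • A) = p.eval z • pev z A := by
  ext i j; simp [pev]

theorem pev_one {m : Type*} [DecidableEq m] (z : ℂ) : pev z (1 : Matrix m m ℂ[X]) = 1 := by
  ext i j; by_cases h : i = j <;> simp [pev, Matrix.one_apply, h]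

/-- constant polynomial matrix -/
noncomputable def pcn {m n : Type*} (A : Matrix m n ℂ) : Matrix m n ℂ[X] := A.map C

theorem pev_pcn {m n : Type*} (z : ℂ) (A : Matrix m n ℂ) : pev z (pcn A) = A := by
  ext i j; simp [pev, pcn]

theorem pcn_mul {m n o : Type*} [Fintype n] (A : Matrix m n ℂ) (B : Matrix n o ℂ) :
    pcn (A * B) = pcn A * pcn B := by
  simp [pcn, Matrix.map_mul]

theorem pcn_star {m n : Type*} (A : Matrix m n ℂ) : (pcn A)ᴴ = pcn Aᴴ := by
  ext1 i j
  simp [pcn, star_C_poly]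

theorem pcn_one {m : Type*} [DecidableEq m] : pcn (1 : Matrix m m ℂ) = 1 := by
  ext1 i j; by_cases h : i = j <;> simp [pcn, Matrix.one_apply, h]

theorem exists_div {m n : Type*} (a : ℂ) (A : Matrix m n ℂ[X]) (h : pev a A = 0) :
    ∃ B : Matrix m n ℂ[X], A = (X - C a) • B := by
  have : ∀ i j, ∃ q, A i j = (X - C a) * q := by
    intro i j
    have h1 : (A i j).IsRoot a := congrFun (congrFun h i) j
    exact (Polynomial.dvd_iff_isRoot.mpr h1)
  choose B hB using this
  exact ⟨Matrix.of B, by ext1 i j; simp [hB]⟩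

theorem poly_eq_of_real (p q : ℂ[X]) (h : ∀ t : ℝ, p.eval (t : ℂ) = q.eval (t : ℂ)) : p = q := by
  apply Polynomial.eq_of_infinite_eval_eq
  apply Set.Infinite.mono (s := Set.range ((↑) : ℝ → ℂ))
  · rintro _ ⟨t, rfl⟩; exact h t
  · exact Set.infinite_range_of_injective Complex.ofReal_injective

theorem pmat_eq_of_real {m n : Type*} (A B : Matrix m n ℂ[X])
    (h : ∀ t : ℝ, pev (t : ℂ) A = pev (t : ℂ) B) : A = B := by
  ext1 i j
  exact poly_eq_of_real _ _ fun t => congrFun (congrFun (h t) i) j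

/-- Rank factorization of PSD matrices. -/
theorem psd_factor {𝕜 : Type*} [RCLike 𝕜] {n : ℕ} (H : Matrix (Fin n) (Fin n) 𝕜)
    (hH : H.PosSemidef) (r : ℕ) (hr : H.rank = r) :
    ∃ (V : Matrix (Fin r) (Fin n) 𝕜) (D : Fin r → ℝ), Vᴴ * V = H ∧ (∀ i, 0 < D i) ∧
      V * Vᴴ = Matrix.diagonal (fun i => (D i : 𝕜)) := by
  have hh := hH.isHermitian
  have hc := hh.rank_eq_card_non_zero_eigs
  rw [hr] at hc
  let e : Fin r ≃ {i // hh.eigenvalues i ≠ 0} := (Fintype.equivFinOfCardEq hc.symm).symm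
  have hnn : ∀ i, 0 ≤ hh.eigenvalues i := hH.eigenvalues_nonneg
  set U : Matrix (Fin n) (Fin n) 𝕜 := hh.eigenvectorUnitary.1 with hU
  have hU1 : Uᴴ * U = 1 := by
    have := (Matrix.mem_unitaryGroup_iff' (A := U)).1 hh.eigenvectorUnitary.2
    exact this
  have hspec : H = U * Matrix.diagonal (RCLike.ofReal ∘ hh.eigenvalues) * Uᴴ := by
    have := hh.spectral_theorem
    rw [Unitary.conjStarAlgAut_apply] at this
    exact this
  refine ⟨Matrix.of fun i j => (Real.sqrt (hh.eigenvalues (e i)) : 𝕜) * star (U j (e i)),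
    fun i => hh.eigenvalues (e i), ?_, ?_, ?_⟩
  · conv_rhs => rw [hspec]
    ext i j
    rw [Matrix.mul_apply, Matrix.mul_apply]
    simp only [Matrix.conjTranspose_apply, Matrix.of_apply, Matrix.mul_diagonal,
      Function.comp]
    have key : ∀ x : Fin r, star ((Real.sqrt (hh.eigenvalues (e x)) : 𝕜) * star (U i (e x))) *
        ((Real.sqrt (hh.eigenvalues (e x)) : 𝕜) * star (U j (e x))) =
        (fun k : {i // hh.eigenvalues i ≠ 0} =>
          U i k * (hh.eigenvalues k : 𝕜) * star (U j k)) (e x) := by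
      intro x
      have hs : (Real.sqrt (hh.eigenvalues (e x)) : 𝕜) * (Real.sqrt (hh.eigenvalues (e x)) : 𝕜)
          = (hh.eigenvalues (e x) : 𝕜) := by
        rw [← RCLike.ofReal_mul, Real.mul_self_sqrt (hnn _)]
      simp only [star_mul', RCLike.star_def, RCLike.conj_ofReal, RCLike.conj_conj]
      rw [← hs]; ring
    rw [Finset.sum_congr rfl (fun x _ => key x), Equiv.sum_comp e
      (fun k : {i // hh.eigenvalues i ≠ 0} => U i k * (hh.eigenvalues k : 𝕜) * star (U j k))]
    rw [← Finset.sum_subtype (Finset.univ.filter fun k => hh.eigenvalues k ≠ 0) (by simp)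
      (fun k => U i k * (hh.eigenvalues k : 𝕜) * star (U j k))]
    apply Finset.sum_filter_of_ne
    intro x _ hx h0
    apply hx
    simp [h0]
  · intro i
    exact lt_of_le_of_ne (hnn _) (Ne.symm (e i).2)
  · ext i j
    have h2 := congrFun (congrFun hU1 (e i)) (e j)
    simp only [Matrix.mul_apply, Matrix.conjTranspose_apply, Matrix.of_apply] at h2 ⊢
    have key : ∀ x : Fin n, (Real.sqrt (hh.eigenvalues (e i)) : 𝕜) * star (U x (e i)) *
        star ((Real.sqrt (hh.eigenvalues (e j)) : 𝕜) * star (U x (e j))) =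
        ((Real.sqrt (hh.eigenvalues (e i)) : 𝕜) * (Real.sqrt (hh.eigenvalues (e j)) : 𝕜)) *
          (star (U x (e i)) * U x (e j)) := by
      intro x
      simp only [star_mul', RCLike.star_def, RCLike.conj_ofReal, RCLike.conj_conj]
      ring
    rw [Finset.sum_congr rfl (fun x _ => key x), ← Finset.mul_sum, h2]
    by_cases hij : i = j
    · subst hij
      rw [Matrix.one_apply_eq, Matrix.diagonal_apply_eq, mul_one, ← RCLike.ofReal_mul,
        Real.mul_self_sqrt (hnn _)]
    · rw [Matrix.diagonal_apply_ne _ hij, Matrix.one_apply_ne, mul_zero]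
      intro h
      exact hij (e.injective (Subtype.ext h))

/-- orthogonal projection onto the column space -/
theorem exists_proj {m n : ℕ} (A : Matrix (Fin m) (Fin n) ℂ) :
    ∃ Q : Matrix (Fin m) (Fin m) ℂ, Qᴴ = Q ∧ Q * Q = Q ∧ Q * A = A ∧
      ∀ (o : ℕ) (B : Matrix (Fin m) (Fin o) ℂ), Aᴴ * B = 0 → Q * B = 0 := by
  obtain ⟨V, D, h1, hD, h2⟩ := psd_factor (A * Aᴴ) (Matrix.posSemidef_self_mul_conjTranspose A) _ rfl
  generalize (A * Aᴴ).rank = r at V D h1 hD h2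
  set E : Matrix (Fin r) (Fin r) ℂ := Matrix.diagonal (fun i => ((D i)⁻¹ : ℂ)) with hE
  have hEE : E * (V * Vᴴ) = 1 := by
    rw [h2, hE, Matrix.diagonal_mul_diagonal, ← Matrix.diagonal_one]
    congr 1
    ext i
    have : (D i : ℂ) ≠ 0 := by exact_mod_cast (hD i).ne'
    simpa using inv_mul_cancel₀ this
  have hEH : Eᴴ = E := by
    rw [hE, Matrix.diagonal_conjTranspose]
    congr 1
    ext i
    simp
  have hVA : ∀ (o : ℕ) (B : Matrix (Fin m) (Fin o) ℂ), Aᴴ * B = 0 → V * B = 0 := by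
    intro o B hB
    have : (Vᴴ * V) * B = 0 := by rw [h1, Matrix.mul_assoc, hB, Matrix.mul_zero]
    rw [← Matrix.conjTranspose_mul_self_eq_zero, Matrix.conjTranspose_mul, Matrix.mul_assoc,
      ← Matrix.mul_assoc Vᴴ, this, Matrix.mul_zero]
  have hQQ : (Vᴴ * E * V) * (Vᴴ * E * V) = Vᴴ * E * V := by
    calc _ = Vᴴ * (E * (V * Vᴴ)) * E * V := by simp only [Matrix.mul_assoc]
      _ = _ := by rw [hEE, Matrix.mul_one]
  have hQH : (Vᴴ * E * V)ᴴ = Vᴴ * E * V := by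
    simp [Matrix.conjTranspose_mul, hEH, Matrix.mul_assoc]
  refine ⟨Vᴴ * E * V, hQH, hQQ, ?_, ?_⟩
  · have h3 : (1 - Vᴴ * E * V) * (A * Aᴴ) = 0 := by
      rw [← h1, Matrix.sub_mul, Matrix.one_mul]
      have : Vᴴ * E * V * (Vᴴ * V) = Vᴴ * (E * (V * Vᴴ)) * V := by simp only [Matrix.mul_assoc]
      rw [this, hEE, Matrix.mul_one, sub_self]
    have h4 : ((1 - Vᴴ * E * V) * A) = 0 := by
      rw [← Matrix.self_mul_conjTranspose_eq_zero, Matrix.conjTranspose_mul, ← Matrix.mul_assoc,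
        Matrix.mul_assoc _ A, h3, Matrix.zero_mul]
    rw [Matrix.sub_mul, Matrix.one_mul, sub_eq_zero] at h4
    exact h4.symm
  · intro o B hB
    rw [Matrix.mul_assoc, hVA o B hB, Matrix.mul_zero]

theorem X_sub_C_ne (a : ℂ) : (X - C a : ℂ[X]) ≠ 0 := Polynomial.X_sub_C_ne_zero a

theorem smul_cancel {m n : Type*} {p : ℂ[X]} (hp : p ≠ 0) {A B : Matrix m n ℂ[X]}
    (h : p • A = p • B) : A = B := by
  ext1 i j
  have := congrFun (congrFun h i) j
  simpa [hp] using this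

theorem divide_one {M N : ℕ} (a : ℂ) (F : Matrix (Fin M) (Fin N) ℂ[X])
    (G : Matrix (Fin N) (Fin N) ℂ[X])
    (h : Fᴴ * F = (star (X - C a : ℂ[X]) * (X - C a)) • G) :
    ∃ Y : Matrix (Fin M) (Fin N) ℂ[X], Yᴴ * Y = G := by
  obtain ⟨Q, hQH, hQQ, hQA, hQB⟩ := exists_proj (pev a F)
  have h1 : (pev a F)ᴴ * pev (star a) F = 0 := by
    have := congrArg (pev (star a)) h
    rw [pev_mul, pev_star, star_star, pev_smul, star_X_sub_C] at this
    simpa using this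
  have h2 := hQB N _ h1
  set K := pcn Q with hK
  have hKH : Kᴴ = K := by rw [hK, pcn_star, hQH]
  have hKK : K * K = K := by rw [hK, ← pcn_mul, hQQ]
  obtain ⟨W, hW⟩ := exists_div a ((1 - K) * F) (by
    rw [pev_mul, pev_sub, pev_one, pev_pcn, Matrix.sub_mul, hQA, Matrix.one_mul, sub_self])
  obtain ⟨Z, hZ⟩ := exists_div (star a) (K * F) (by rw [pev_mul, pev_pcn, h2])
  have hLL : (1 - K)ᴴ * (1 - K) = 1 - K := by
    rw [Matrix.conjTranspose_sub, Matrix.conjTranspose_one, hKH]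
    noncomm_ring [hKK]
  have hLK : (1 - K)ᴴ * K = 0 := by
    rw [Matrix.conjTranspose_sub, Matrix.conjTranspose_one, hKH, Matrix.sub_mul, hKK,
      Matrix.one_mul, sub_self]
  set p : ℂ[X] := X - C a with hp
  have hsp : star p = X - C (star a) := star_X_sub_C a
  have hp0 : p ≠ 0 := X_sub_C_ne a
  have hsp0 : star p ≠ 0 := by rw [hsp]; exact X_sub_C_ne _
  rw [← hsp] at hZ
  have e1 : (star p * p) • (Wᴴ * W) = Fᴴ * (1 - K) * F := by
    have : (star p * p) • (Wᴴ * W) = (p • W)ᴴ * (p • W) := by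
      rw [Matrix.conjTranspose_smul, Matrix.smul_mul, Matrix.mul_smul, smul_smul]
    rw [this, ← hW, Matrix.conjTranspose_mul, Matrix.mul_assoc, ← Matrix.mul_assoc _ (1 - K), hLL,
      Matrix.mul_assoc]
  have e2 : (star p * p) • (Zᴴ * Z) = Fᴴ * K * F := by
    have : (star p * p) • (Zᴴ * Z) = (star p • Z)ᴴ * (star p • Z) := by
      rw [Matrix.conjTranspose_smul, Matrix.smul_mul, Matrix.mul_smul, smul_smul, star_star,
        mul_comm]
    rw [this, ← hZ, Matrix.conjTranspose_mul, Matrix.mul_assoc, ← Matrix.mul_assoc _ K, hKH, hKK,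
      Matrix.mul_assoc]
  have e3 : Wᴴ * Z = 0 := by
    apply smul_cancel (mul_ne_zero hsp0 hsp0)
    have : (star p * star p) • (Wᴴ * Z) = (p • W)ᴴ * (star p • Z) := by
      rw [Matrix.conjTranspose_smul, Matrix.smul_mul, Matrix.mul_smul, smul_smul]
    rw [this, ← hZ, ← hW, Matrix.conjTranspose_mul, Matrix.mul_assoc, ← Matrix.mul_assoc _ K, hLK,
      Matrix.zero_mul, Matrix.mul_zero, smul_zero]
  have e4 : Zᴴ * W = 0 := by
    have := congrArg Matrix.conjTranspose e3
    simpa [Matrix.conjTranspose_mul] using this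
  refine ⟨W + Z, ?_⟩
  apply smul_cancel (mul_ne_zero hsp0 hp0)
  rw [← h, Matrix.conjTranspose_add, Matrix.add_mul, Matrix.mul_add, Matrix.mul_add, e3, e4,
    add_zero, zero_add, smul_add, e1, e2, ← Matrix.add_mul, ← Matrix.mul_add]
  simp

theorem divide_all {M N : ℕ} (n : ℕ) : ∀ (h : ℂ[X]), h ≠ 0 → h.natDegree = n →
    ∀ (F : Matrix (Fin M) (Fin N) ℂ[X])
    (G : Matrix (Fin N) (Fin N) ℂ[X]), Fᴴ * F = (star h * h) • G →
    ∃ Y : Matrix (Fin M) (Fin N) ℂ[X], Yᴴ * Y = G := by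
  induction n with
  | zero =>
    intro h h0 hd F G hF
    rw [Polynomial.natDegree_eq_zero] at hd
    obtain ⟨c, rfl⟩ := hd
    have hc : c ≠ 0 := by rintro rfl; simp at h0
    refine ⟨C c⁻¹ • F, ?_⟩
    rw [Matrix.conjTranspose_smul, Matrix.smul_mul, Matrix.mul_smul, hF, smul_smul, smul_smul,
      star_C_poly, star_C_poly, ← C_mul, ← C_mul, ← C_mul]
    have : star c⁻¹ * c⁻¹ * (star c * c) = 1 := by
      have : star c ≠ 0 := by simpa using hc
      rw [star_inv₀]; field_simp
    rw [this]; simp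
  | succ n ih =>
    intro h h0 hd F G hF
    obtain ⟨a, ha⟩ := Complex.exists_root (f := h) (by
      rw [← Polynomial.natDegree_pos_iff_degree_pos]; omega)
    obtain ⟨q, rfl⟩ := Polynomial.dvd_iff_isRoot.mpr ha
    have hq : q ≠ 0 := right_ne_zero_of_mul h0
    have hqd : q.natDegree = n := by
      rw [Polynomial.natDegree_mul (X_sub_C_ne a) hq, Polynomial.natDegree_X_sub_C] at hd
      omega
    obtain ⟨Y, hY⟩ := divide_one a F ((star q * q) • G) (by
      rw [hF, smul_smul, star_mul]; congr 1; ring)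
    exact ih q hq hqd Y G hY

/-- degree bound -/
theorem degree_bound {M : ℕ} (f : Fin M → ℂ[X]) (P : ℕ)
    (h : (∑ i, star (f i) * f i).natDegree ≤ 2 * P) : ∀ i, (f i).natDegree ≤ P := by
  set k := Finset.univ.sup (fun i => (f i).natDegree) with hk
  have hle : ∀ i, (f i).natDegree ≤ k := fun i => by
    rw [hk]; exact Finset.le_sup (f := fun i => (f i).natDegree) (Finset.mem_univ i)
  by_contra hcon
  push Not at hcon
  obtain ⟨i0, hi0⟩ := hcon
  have hkP : P < k := lt_of_lt_of_le hi0 (hle i0)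
  obtain ⟨j, -, hj⟩ := Finset.exists_mem_eq_sup Finset.univ ⟨i0, Finset.mem_univ i0⟩
    (fun i => (f i).natDegree)
  rw [← hk] at hj
  have hc : (∑ i, star (f i) * f i).coeff (k + k) = 0 :=
    Polynomial.coeff_eq_zero_of_natDegree_lt (by omega)
  have hc2 : ∀ i, (star (f i) * f i).coeff (k + k) = star ((f i).coeff k) * (f i).coeff k := by
    intro i
    rw [Polynomial.coeff_mul_add_eq_of_natDegree_le _ (hle i), coeff_star_poly]
    rw [poly_star_def]
    exact (Polynomial.natDegree_map_le).trans (hle i)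
  rw [Polynomial.finsetSum_coeff, Finset.sum_congr rfl (fun i _ => hc2 i),
    Finset.sum_eq_zero_iff_of_nonneg (fun i _ => star_mul_self_nonneg _)] at hc
  have h3 := hc j (Finset.mem_univ j)
  have h4 : (f j).coeff k = 0 := by simpa using h3
  rw [hj, Polynomial.coeff_natDegree, Polynomial.leadingCoeff_eq_zero] at h4
  rw [h4] at hj
  simp at hj
  omega

theorem row_const {M N : ℕ} (c : Matrix (Fin 1) (Fin M) ℂ) (hc : c ≠ 0)
    (F : Matrix (Fin M) (Fin N) ℂ[X]) (h : pcn c * F = 0) :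
    ∃ M' < M, ∃ Y : Matrix (Fin M') (Fin N) ℂ[X], Yᴴ * Y = Fᴴ * F := by
  obtain ⟨Q, hQH, hQQ, hQA, hQB⟩ := exists_proj cᴴ
  have hL : (1 - Q)ᴴ * (1 - Q) = 1 - Q := by
    rw [Matrix.conjTranspose_sub, Matrix.conjTranspose_one, hQH]
    noncomm_ring [hQQ]
  have hpsd : (1 - Q).PosSemidef := by
    rw [← hL]; exact Matrix.posSemidef_conjTranspose_mul_self _
  have hdet : (1 - Q).det = 0 := by
    rw [← Matrix.exists_mulVec_eq_zero_iff]
    refine ⟨fun i => cᴴ i 0, ?_, ?_⟩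
    · intro h0
      apply hc
      ext i j
      have := congrFun h0 j
      fin_cases i
      simpa using this
    · have : (1 - Q) * cᴴ = 0 := by rw [Matrix.sub_mul, hQA, Matrix.one_mul, sub_self]
      ext i
      exact congrFun (congrFun this i) 0
  have hrk : (1 - Q).rank < M := by
    refine lt_of_le_of_ne ((Matrix.rank_le_height _)) ?_
    intro hr
    obtain ⟨V, D, h1, hD, h2⟩ := psd_factor (1 - Q) hpsd M hr
    have : (V * Vᴴ).det = 0 := by rw [Matrix.det_mul_comm, h1, hdet]
    rw [h2, Matrix.det_diagonal, Finset.prod_eq_zero_iff] at this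
    obtain ⟨i, -, hi⟩ := this
    have := hD i
    have hi' : D i = 0 := by simpa using hi
    linarith
  obtain ⟨V, D, h1, hD, h2⟩ := psd_factor (1 - Q) hpsd _ rfl
  refine ⟨_, hrk, pcn V * F, ?_⟩
  have hQF : pcn Q * F = 0 := by
    apply pmat_eq_of_real
    intro t
    have h3 := congrArg (pev (t : ℂ)) h
    rw [pev_mul, pev_pcn] at h3 ⊢
    have h0 : ∀ m n : ℕ, pev (t : ℂ) (0 : Matrix (Fin m) (Fin n) ℂ[X]) = 0 := by
      intro m n; ext i j; simp [pev]
    rw [h0] at h3 ⊢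
    apply hQB
    rw [Matrix.conjTranspose_conjTranspose, h3]
  have e1 : (1 : Matrix (Fin M) (Fin M) ℂ[X]) - pcn Q = pcn (1 - Q) := by
    ext1 i j
    by_cases hij : i = j <;> simp [pcn, hij]
  rw [Matrix.conjTranspose_mul, Matrix.mul_assoc, ← Matrix.mul_assoc _ (pcn V), pcn_star,
    ← pcn_mul, h1, ← e1, Matrix.sub_mul, hQF, Matrix.one_mul, sub_zero]

theorem natDegree_of_smul {p : ℂ[X]} {a : ℂ} {k : ℕ} (h : ((X - C a) * p).natDegree ≤ k + 1) :
    p.natDegree ≤ k := by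
  by_cases hp : p = 0
  · simp [hp]
  · rw [Polynomial.natDegree_mul (X_sub_C_ne a) hp, Polynomial.natDegree_X_sub_C] at h
    omega

theorem natDegree_mul_pcn {m n o : Type*} [Fintype n] (v : Matrix m n ℂ[X]) (Q : Matrix n o ℂ)
    (k : ℕ) (h : ∀ i j, (v i j).natDegree ≤ k) (i j) : ((v * pcn Q) i j).natDegree ≤ k := by
  rw [Matrix.mul_apply]
  apply Polynomial.natDegree_sum_le_of_forall_le
  intro x _
  simp only [pcn, Matrix.map_apply]
  exact (Polynomial.natDegree_mul_C_le _ _).trans (h i x)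

theorem row_reduce {M N : ℕ} (k : ℕ) : ∀ (v : Matrix (Fin 1) (Fin M) ℂ[X]), v ≠ 0 →
    (∀ i j, (v i j).natDegree ≤ k) → ∀ (F : Matrix (Fin M) (Fin N) ℂ[X]), v * F = 0 →
    ∃ M' < M, ∃ Y : Matrix (Fin M') (Fin N) ℂ[X], Yᴴ * Y = Fᴴ * F := by
  have base : ∀ (v : Matrix (Fin 1) (Fin M) ℂ[X]), v ≠ 0 →
    (∀ i j, (v i j).natDegree ≤ 0) → ∀ (F : Matrix (Fin M) (Fin N) ℂ[X]), v * F = 0 →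
    ∃ M' < M, ∃ Y : Matrix (Fin M') (Fin N) ℂ[X], Yᴴ * Y = Fᴴ * F := by
    intro v hv hd F hF
    have : v = pcn (pev 0 v) := by
      ext1 i j
      have := Polynomial.eq_C_of_natDegree_le_zero (hd i j)
      rw [pcn, pev, Matrix.map_apply, Matrix.map_apply, ← Polynomial.coeff_zero_eq_eval_zero]
      exact this
    rw [this] at hF
    refine row_const (pev 0 v) ?_ F hF
    intro h0
    apply hv
    rw [this, h0]
    ext1 i j
    simp [pcn]
  induction k with
  | zero => exact base
  | succ k ih =>
    intro v hv hd F hF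
    by_cases hq : ((v * vᴴ) 0 0).natDegree ≤ 0
    · refine base v hv ?_ F hF
      have h1 : ((v * vᴴ) 0 0) = ∑ j, star (v 0 j) * v 0 j := by
        rw [Matrix.mul_apply]
        exact Finset.sum_congr rfl fun j _ => by rw [Matrix.conjTranspose_apply, mul_comm]
      intro i j
      fin_cases i
      exact degree_bound (fun j => v 0 j) 0 (by rw [← h1]; simpa using hq) j
    · obtain ⟨z, hz⟩ := Complex.exists_root (f := (v * vᴴ) 0 0) (by
        rw [← Polynomial.natDegree_pos_iff_degree_pos]; omega)
      have hvv : pev z v * (pev (star z) v)ᴴ = 0 := by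
        rw [← pev_star, ← pev_mul]
        ext i j
        fin_cases i; fin_cases j
        exact hz
      obtain ⟨Q, hQH, hQQ, hQA, hQB⟩ := exists_proj (pev z v)ᴴ
      rw [Matrix.conjTranspose_conjTranspose] at hQB
      have hA : pev z v * Q = pev z v := by
        have := congrArg Matrix.conjTranspose hQA
        simpa [Matrix.conjTranspose_mul, hQH] using this
      have hB : pev (star z) v * Q = 0 := by
        have := congrArg Matrix.conjTranspose (hQB _ _ hvv)
        simpa [Matrix.conjTranspose_mul, hQH] using this
      have hZ0 : Q * pev z F = 0 := by
        apply hQB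
        rw [← pev_mul, hF]
        ext i j; simp [pev]
      set K := pcn Q with hK
      have hKH : Kᴴ = K := by rw [hK, pcn_star, hQH]
      have hKK : K * K = K := by rw [hK, ← pcn_mul, hQQ]
      have e1 : (1 : Matrix (Fin M) (Fin M) ℂ[X]) - K = pcn (1 - Q) := by
        ext1 i j
        by_cases hij : i = j <;> simp [hK, pcn, hij]
      have hK1 : K * (1 - K) = 0 := by rw [Matrix.mul_sub, hKK, Matrix.mul_one, sub_self]
      have hK2 : (1 - K) * K = 0 := by rw [Matrix.sub_mul, hKK, Matrix.one_mul, sub_self]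
      have hK3 : (1 - K) * (1 - K) = 1 - K := by
        rw [Matrix.sub_mul, hK1, Matrix.one_mul, sub_zero]
      obtain ⟨α, hα⟩ := exists_div z (v * (1 - K)) (by
        rw [pev_mul, e1, pev_pcn, Matrix.mul_sub, hA, Matrix.mul_one, sub_self])
      obtain ⟨β, hβ⟩ := exists_div (star z) (v * K) (by rw [pev_mul, pev_pcn, hB])
      obtain ⟨Z, hZ⟩ := exists_div z (K * F) (by rw [pev_mul, pev_pcn, hZ0])
      have hαK : α * K = 0 := by
        apply smul_cancel (X_sub_C_ne z)
        rw [← Matrix.smul_mul, ← hα, Matrix.mul_assoc, hK2, Matrix.mul_zero, smul_zero]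
      have hβK : β * (1 - K) = 0 := by
        apply smul_cancel (X_sub_C_ne (star z))
        rw [← Matrix.smul_mul, ← hβ, Matrix.mul_assoc, hK1, Matrix.mul_zero, smul_zero]
      have hKZ : K * Z = Z := by
        apply smul_cancel (X_sub_C_ne z)
        rw [← Matrix.mul_smul, ← hZ, ← Matrix.mul_assoc, hKK]
      have hLZ : (1 - K) * Z = 0 := by rw [Matrix.sub_mul, hKZ, Matrix.one_mul, sub_self]
      have hαZ : α * Z = 0 := by rw [← hKZ, ← Matrix.mul_assoc, hαK, Matrix.zero_mul]
      have hLH : (1 - K)ᴴ = 1 - K := by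
        rw [Matrix.conjTranspose_sub, Matrix.conjTranspose_one, hKH]
      set p : ℂ[X] := X - C z with hp
      have hsp : star p = X - C (star z) := star_X_sub_C z
      have hp0 : p ≠ 0 := X_sub_C_ne z
      rw [← hsp] at hβ
      have hsp0 : star p ≠ 0 := by rw [hsp]; exact X_sub_C_ne _
      have key : ((1 - K) * F + star p • Z)ᴴ * ((1 - K) * F + star p • Z) = Fᴴ * F := by
        have c1 : (star p • Z)ᴴ * ((1 - K) * F) = 0 := by
          rw [← Matrix.mul_assoc]
          have : (star p • Z)ᴴ * (1 - K) = 0 := by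
            have := congrArg Matrix.conjTranspose hLZ
            rw [Matrix.conjTranspose_mul, hLH, Matrix.conjTranspose_zero] at this
            rw [Matrix.conjTranspose_smul, Matrix.smul_mul, this, smul_zero]
          rw [this, Matrix.zero_mul]
        have c2 : ((1 - K) * F)ᴴ * (star p • Z) = 0 := by
          have := congrArg Matrix.conjTranspose c1
          simpa only [Matrix.conjTranspose_mul, Matrix.conjTranspose_conjTranspose,
            Matrix.conjTranspose_zero] using this
        have c3 : (star p • Z)ᴴ * (star p • Z) = Fᴴ * K * F := by
          have : (star p • Z)ᴴ * (star p • Z) = (p • Z)ᴴ * (p • Z) := by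
            simp only [Matrix.conjTranspose_smul, Matrix.smul_mul, Matrix.mul_smul, smul_smul,
              star_star]
            rw [mul_comm]
          rw [this, ← hZ, Matrix.conjTranspose_mul, Matrix.mul_assoc, ← Matrix.mul_assoc _ K, hKH,
            hKK, Matrix.mul_assoc]
        have c4 : ((1 - K) * F)ᴴ * ((1 - K) * F) = Fᴴ * (1 - K) * F := by
          rw [Matrix.conjTranspose_mul, Matrix.mul_assoc, ← Matrix.mul_assoc _ (1 - K), hLH,
            hK3, Matrix.mul_assoc]
        rw [Matrix.conjTranspose_add, Matrix.add_mul, Matrix.mul_add, Matrix.mul_add, c1, c2, c3,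
          c4, add_zero, zero_add, ← Matrix.add_mul, ← Matrix.mul_add]
        simp
      rw [← key]
      apply ih (α + β)
      · intro h0
        have hb : β = 0 := by
          have h5 : (α + β) * K = 0 := by rw [h0, Matrix.zero_mul]
          rw [Matrix.add_mul, hαK, zero_add] at h5
          rw [Matrix.mul_sub, h5, Matrix.mul_one, sub_zero] at hβK
          exact hβK
        have ha : α = 0 := by rw [hb, add_zero] at h0; exact h0
        apply hv
        have : v = v * (1 - K) + v * K := by rw [← Matrix.mul_add]; simp
        rw [this, hα, hβ, ha, hb]; simp
      · intro i j
        rw [Matrix.add_apply]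
        refine (Polynomial.natDegree_add_le _ _).trans (max_le ?_ ?_)
        · apply natDegree_of_smul (a := z)
          have := natDegree_mul_pcn v (1 - Q) (k + 1) hd i j
          rw [← e1, hα] at this
          simpa using this
        · apply natDegree_of_smul (a := star z)
          have := natDegree_mul_pcn v Q (k + 1) hd i j
          rw [← hK, hβ, hsp] at this
          simpa using this
      · apply smul_cancel hp0
        have d1 : β * ((1 - K) * F) = 0 := by rw [← Matrix.mul_assoc, hβK, Matrix.zero_mul]
        have d2 : p • (α * ((1 - K) * F)) = v * ((1 - K) * F) := by
          rw [← Matrix.smul_mul, ← hα, Matrix.mul_assoc, ← Matrix.mul_assoc (1 - K), hK3]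
        have d3 : p • (β * (star p • Z)) = v * (K * F) := by
          rw [Matrix.mul_smul, ← Matrix.smul_mul, ← hβ, ← Matrix.mul_smul, Matrix.mul_assoc,
            Matrix.mul_smul, hKZ, ← hZ]
        have d4 : α * (star p • Z) = 0 := by rw [Matrix.mul_smul, hαZ, smul_zero]
        rw [Matrix.add_mul, Matrix.mul_add, Matrix.mul_add, d1, d4, zero_add, add_zero, smul_add,
          d2, d3, ← Matrix.mul_add, ← Matrix.add_mul]
        simp [hF]

theorem closed_nonneg (r : ℂ[X]) : IsClosed {t : ℝ | 0 ≤ r.eval (t : ℂ)} := by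
  have hc : Continuous fun t : ℝ => r.eval (t : ℂ) :=
    r.continuous.comp Complex.continuous_ofReal
  have : {t : ℝ | 0 ≤ r.eval (t : ℂ)} =
      {t : ℝ | 0 ≤ (r.eval (t : ℂ)).re} ∩ {t : ℝ | 0 = (r.eval (t : ℂ)).im} := by
    ext t; simp [Complex.le_def]
  rw [this]
  exact (isClosed_le continuous_const (Complex.continuous_re.comp hc)).inter
    (isClosed_eq continuous_const (Complex.continuous_im.comp hc))

theorem nonneg_of_mul_pos {c : ℝ} (hc : 0 < c) {z : ℂ} (h : 0 ≤ (c : ℂ) * z) : 0 ≤ z := by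
  rw [Complex.le_def] at h ⊢
  simp only [Complex.zero_re, Complex.re_ofReal_mul, Complex.zero_im, Complex.im_ofReal_mul] at h ⊢
  refine ⟨nonneg_of_mul_nonneg_right h.1 hc, ?_⟩
  have := h.2.symm
  rcases mul_eq_zero.mp this with h | h
  · exact absurd h hc.ne'
  · exact h.symm

theorem scalar_fr (n : ℕ) : ∀ p : ℂ[X], p.natDegree ≤ n →
    (∀ t : ℝ, 0 ≤ p.eval (t : ℂ)) → ∃ f : ℂ[X], star f * f = p := by
  induction n using Nat.strong_induction_on with
  | _ n ih =>
  intro p hpn hp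
  by_cases hd : p.natDegree = 0
  · rw [Polynomial.natDegree_eq_zero] at hd
    obtain ⟨c, rfl⟩ := hd
    have hc := hp 0
    rw [eval_C] at hc
    refine ⟨C (Real.sqrt c.re : ℂ), ?_⟩
    rw [star_C_poly, ← C_mul]
    congr 1
    rw [Complex.le_def] at hc
    apply Complex.ext
    · simp [Real.mul_self_sqrt hc.1]
    · simpa using hc.2
  have hp0 : p ≠ 0 := by rintro rfl; simp at hd
  have hsp : star p = p := by
    apply poly_eq_of_real
    intro t
    rw [eval_star_poly]
    have : star (t : ℂ) = t := by simp
    rw [this]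
    exact (IsSelfAdjoint.of_nonneg (hp t)).star_eq
  obtain ⟨a, ha⟩ := Complex.exists_root (f := p) (by
      rw [← Polynomial.natDegree_pos_iff_degree_pos]; omega)
  obtain ⟨q, hq⟩ := Polynomial.dvd_iff_isRoot.mpr ha
  have hqa : q.eval (star a) = 0 := by
    by_cases har : star a = a
    · obtain ⟨x, rfl⟩ : ∃ x : ℝ, a = x := by
        refine ⟨a.re, ?_⟩
        exact (Complex.conj_eq_iff_re.mp har).symm
      rw [har]
      have h1 : 0 ≤ q.eval (x : ℂ) := by
        have : x ∈ closure (Set.Ioi x) := by simp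
        refine closure_minimal ?_ (closed_nonneg q) this
        intro t ht
        have h := hp t
        rw [hq] at h
        simp only [eval_mul, eval_sub, eval_X, eval_C] at h
        rw [← Complex.ofReal_sub] at h
        exact nonneg_of_mul_pos (sub_pos.mpr ht) h
      have h2 : 0 ≤ (-q).eval (x : ℂ) := by
        have : x ∈ closure (Set.Iio x) := by simp
        refine closure_minimal ?_ (closed_nonneg (-q)) this
        intro t ht
        have h := hp t
        rw [hq] at h
        simp only [eval_mul, eval_sub, eval_X, eval_C] at h
        refine nonneg_of_mul_pos (sub_pos.mpr (show t < x from ht)) ?_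
        rw [eval_neg, Complex.ofReal_sub]
        convert h using 1
        ring
      rw [eval_neg] at h2
      exact le_antisymm (neg_nonneg.mp h2) h1
    · have : p.eval (star a) = 0 := by
        have h := eval_star_poly p (star a)
        rw [hsp, star_star, show p.eval a = 0 from ha, star_zero] at h
        exact h
      rw [hq] at this
      simp only [eval_mul, eval_sub, eval_X, eval_C] at this
      rcases mul_eq_zero.mp this with h | h
      · exact absurd (sub_eq_zero.mp h) har
      · exact h
  obtain ⟨r, hr⟩ := Polynomial.dvd_iff_isRoot.mpr hqa
  have hq0 : q ≠ 0 := by rintro rfl; simp at hq; exact hp0 hq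
  have hr0 : r ≠ 0 := by rintro rfl; simp at hr; exact hq0 hr
  have hdeg : p.natDegree = r.natDegree + 2 := by
    rw [hq, Polynomial.natDegree_mul (X_sub_C_ne a) hq0, hr,
      Polynomial.natDegree_mul (X_sub_C_ne _) hr0, Polynomial.natDegree_X_sub_C,
      Polynomial.natDegree_X_sub_C]
    omega
  have hpr : p = star (X - C a) * (X - C a) * r := by
    rw [hq, hr, star_X_sub_C]; ring
  have hrn : ∀ t : ℝ, 0 ≤ r.eval (t : ℂ) := by
    intro t
    have hd : t ∈ closure ({a.re}ᶜ : Set ℝ) := by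
      rw [(dense_compl_singleton a.re).closure_eq]; trivial
    refine closure_minimal ?_ (closed_nonneg r) hd
    intro s hs
    have h := hp s
    rw [hpr, eval_mul, eval_mul, eval_star_poly] at h
    have hss : star (s : ℂ) = s := by simp
    rw [hss] at h
    simp only [eval_sub, eval_X, eval_C] at h
    have h3 : star ((s : ℂ) - a) * ((s : ℂ) - a) = ((Complex.normSq (s - a) : ℝ) : ℂ) := by
      rw [Complex.normSq_eq_conj_mul_self]; rfl
    rw [h3] at h
    refine nonneg_of_mul_pos ?_ h
    rw [Complex.normSq_pos]
    intro h4
    apply hs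
    have := congrArg Complex.re h4
    simp at this
    simp; linarith
  obtain ⟨f, hf⟩ := ih r.natDegree (by omega) r le_rfl hrn
  refine ⟨(X - C a) * f, ?_⟩
  rw [hpr, ← hf, star_mul]; ring

def IsSOS {N : ℕ} (G : Matrix (Fin N) (Fin N) ℂ[X]) : Prop :=
  ∃ M : ℕ, ∃ F : Matrix (Fin M) (Fin N) ℂ[X], Fᴴ * F = G

theorem IsSOS.add {N : ℕ} {G H : Matrix (Fin N) (Fin N) ℂ[X]} (hG : IsSOS G) (hH : IsSOS H) :
    IsSOS (G + H) := by
  obtain ⟨m, A, rfl⟩ := hG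
  obtain ⟨n, B, rfl⟩ := hH
  refine ⟨m + n, (Matrix.fromRows A B).submatrix finSumFinEquiv.symm id, ?_⟩
  rw [Matrix.conjTranspose_submatrix, Matrix.submatrix_mul_equiv,
    Matrix.conjTranspose_fromRows_eq_fromCols_conjTranspose, Matrix.fromCols_mul_fromRows]
  rfl

theorem IsSOS.smul {N : ℕ} {G : Matrix (Fin N) (Fin N) ℂ[X]} (hG : IsSOS G) (f : ℂ[X]) :
    IsSOS ((star f * f) • G) := by
  obtain ⟨m, A, rfl⟩ := hG
  refine ⟨m, f • A, ?_⟩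
  rw [Matrix.conjTranspose_smul, Matrix.smul_mul, Matrix.mul_smul, smul_smul]

theorem psd_pivot {N : ℕ} (H : Matrix (Fin N) (Fin N) ℂ) (hH : H.PosSemidef) (i : Fin N) :
    ((H i i * H i i) • H - H i i • Matrix.of fun a b => H a i * H i b).PosSemidef := by
  set E : Matrix (Fin N) (Fin N) ℂ := Matrix.single i i 1 with hE
  have hEH : Eᴴ = E := by rw [hE]; simp
  have hi : star (H i i) = H i i := hH.isHermitian.apply i i
  have h1 : (Matrix.of fun a b => H a i * H i b) = H * E * H := by
    ext a b
    rw [Matrix.mul_assoc, hE, Matrix.mul_apply, Finset.sum_eq_single i]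
    · simp
    · intro c _ hc
      rw [Matrix.single_mul_apply_of_ne _ _ _ _ _ hc]; simp
    · simp
  have h2 : E * H * E = H i i • E := by
    rw [hE, Matrix.single_mul_mul_single]
    simp
  have h3 := hH.conjTranspose_mul_mul_same (H i i • (1 : Matrix (Fin N) (Fin N) ℂ) - E * H)
  convert h3 using 1
  rw [h1, Matrix.conjTranspose_sub, Matrix.conjTranspose_smul, Matrix.conjTranspose_mul, hEH,
    Matrix.conjTranspose_one, hi, hH.isHermitian.eq]
  have h4 : H * E * H * E * H = H i i • (H * E * H) := by
    calc _ = H * (E * H * E) * H := by simp only [Matrix.mul_assoc]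
      _ = _ := by rw [h2]; simp
  simp only [Matrix.sub_mul, Matrix.mul_sub, Matrix.smul_mul, Matrix.mul_smul, Matrix.one_mul,
    Matrix.mul_one, ← Matrix.mul_assoc, h4, smul_sub, smul_smul]
  abel

theorem sos_denominator {N : ℕ} (n : ℕ) : ∀ G : Matrix (Fin N) (Fin N) ℂ[X],
    (∀ t : ℝ, (pev (t : ℂ) G).PosSemidef) →
    (Finset.univ.filter fun i => G i i ≠ 0).card ≤ n →
    ∃ h : ℂ[X], h ≠ 0 ∧ IsSOS ((star h * h) • G) := by
  induction n with
  | zero =>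
    intro G hG hc
    have hz : ∀ i, G i i = 0 := by
      intro i
      by_contra hi
      have : i ∈ Finset.univ.filter fun i => G i i ≠ 0 := by simp [hi]
      rw [Finset.card_eq_zero.mp (Nat.le_zero.mp hc)] at this
      simp at this
    have : G = 0 := by
      apply pmat_eq_of_real
      intro t
      have h1 : pev (t : ℂ) G = 0 := by
        rw [← (hG t).trace_eq_zero_iff]
        simp [Matrix.trace, pev, hz]
      rw [h1]
      ext i j; simp [pev]
    exact ⟨1, one_ne_zero, 0, 0, by simp [this]⟩
  | succ n ih =>
    intro G hG hc
    by_cases hall : ∀ i, G i i = 0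
    · exact ih G hG (by simp [hall])
    push Not at hall
    obtain ⟨i, hi⟩ := hall
    set g := G i i with hg
    set u : Matrix (Fin 1) (Fin N) ℂ[X] := Matrix.of fun _ b => G i b with hu
    have hherm : Gᴴ = G := by
      apply pmat_eq_of_real
      intro t
      rw [pev_star]
      have : star (t : ℂ) = t := by simp
      rw [this]
      exact (hG t).isHermitian
    have huu : uᴴ * u = Matrix.of fun a b => G a i * G i b := by
      ext1 a b
      rw [Matrix.mul_apply]
      have : star (G i a) = G a i := congrFun (congrFun hherm a) i
      simp [hu, this]
    set S : Matrix (Fin N) (Fin N) ℂ[X] := (g * g) • G - g • (uᴴ * u) with hS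
    have hSp : ∀ t : ℝ, (pev (t : ℂ) S).PosSemidef := by
      intro t
      have := psd_pivot _ (hG t) i
      convert this using 1
      rw [hS, huu, pev_sub, pev_smul, pev_smul, eval_mul]
      congr 2
      ext a b
      simp [pev]
    have hgn : ∀ t : ℝ, 0 ≤ g.eval (t : ℂ) := fun t => (hG t).diag_nonneg (i := i)
    obtain ⟨f, hf⟩ := scalar_fr _ g le_rfl hgn
    have hgs : star g = g := by rw [← hf]; simp [mul_comm]
    have hSi : S i i = 0 := by
      rw [hS, huu]
      simp [← hg]; ring
    have hSj : ∀ j, G j j = 0 → S j j = 0 := by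
      intro j hj
      apply poly_eq_of_real
      intro t
      have h1 : 0 ≤ (S j j).eval (t : ℂ) := (hSp t).diag_nonneg (i := j)
      have h2 : S j j = - (g * (star (G i j) * G i j)) := by
        have : star (G i j) = G j i := congrFun (congrFun hherm j) i
        rw [hS, huu, this]
        simp [hj]
      have h3 : 0 ≤ (g * (star (G i j) * G i j)).eval (t : ℂ) := by
        rw [eval_mul, eval_mul, eval_star_poly]
        have : star (t : ℂ) = t := by simp
        rw [this]
        exact mul_nonneg (hgn t) (star_mul_self_nonneg _)
      rw [eval_zero]
      refine le_antisymm ?_ h1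
      rw [h2, eval_neg]
      exact neg_nonpos.mpr h3
    obtain ⟨h, hh0, hh⟩ := ih S hSp (by
      have : (Finset.univ.filter fun j => S j j ≠ 0) ⊂ Finset.univ.filter fun j => G j j ≠ 0 := by
        rw [Finset.ssubset_iff_of_subset]
        · exact ⟨i, by simpa using hi, by simp [hSi]⟩
        · intro j
          simp only [Finset.mem_filter, Finset.mem_univ, true_and]
          exact fun h1 h2 => h1 (hSj j h2)
      have := Finset.card_lt_card this
      omega)
    refine ⟨h * g, mul_ne_zero hh0 hi, ?_⟩
    have e : (star (h * g) * (h * g)) • G =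
        (star (h * f) * (h * f)) • (uᴴ * u) + (star h * h) • S := by
      have : (star (h * f) * (h * f)) = star h * h * g := by
        rw [← hf, star_mul]; ring
      rw [this, hS, smul_sub, smul_smul, smul_smul, star_mul, hgs]
      rw [show g * star h * (h * g) = star h * h * (g * g) by ring]
      abel
    rw [e]
    exact IsSOS.add (IsSOS.smul ⟨1, u, rfl⟩ _) hh

theorem exists_factor {N d : ℕ} (G : Matrix (Fin N) (Fin N) ℂ[X])
    (hG : ∀ t : ℝ, (pev (t : ℂ) G).PosSemidef) (hr : ∀ t : ℝ, (pev (t : ℂ) G).rank ≤ d)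
    (hr0 : (pev ((0 : ℝ) : ℂ) G).rank = d) :
    ∃ F : Matrix (Fin d) (Fin N) ℂ[X], Fᴴ * F = G := by
  classical
  have hex : ∃ M : ℕ, ∃ F : Matrix (Fin M) (Fin N) ℂ[X], Fᴴ * F = G := by
    obtain ⟨h, h0, M, F, hF⟩ := sos_denominator _ G hG le_rfl
    exact ⟨M, divide_all _ h h0 rfl F G hF⟩
  have hpe : ∀ (M : ℕ) (F : Matrix (Fin M) (Fin N) ℂ[X]), Fᴴ * F = G → ∀ t : ℝ,
      (pev (t : ℂ) F)ᴴ * pev (t : ℂ) F = pev (t : ℂ) G := by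
    intro M F hF t
    rw [← hF, pev_mul, pev_star]
    simp
  obtain ⟨M, ⟨F, hF⟩, hmin⟩ : ∃ M : ℕ, (∃ F : Matrix (Fin M) (Fin N) ℂ[X], Fᴴ * F = G) ∧
      ∀ m < M, ¬ ∃ F : Matrix (Fin m) (Fin N) ℂ[X], Fᴴ * F = G :=
    ⟨Nat.find hex, Nat.find_spec hex, fun m => Nat.find_min hex (m := m)⟩
  have h1 : d ≤ M := by
    rw [← hr0, ← hpe M F hF 0, Matrix.rank_conjTranspose_mul_self]
    exact Matrix.rank_le_height _
  rcases h1.eq_or_lt with h2 | h2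
  · rw [h2]; exact ⟨F, hF⟩
  exfalso
  have hdet : (F * Fᴴ).det = 0 := by
    apply poly_eq_of_real
    intro t
    have h3 : (F * Fᴴ).det.eval (t : ℂ) = (pev (t : ℂ) (F * Fᴴ)).det :=
      (RingHom.map_det (Polynomial.evalRingHom (t : ℂ)) (F * Fᴴ))
    rw [h3, eval_zero, pev_mul, pev_star]
    have : star (t : ℂ) = t := by simp
    rw [this]
    by_contra hne
    have h4 := Matrix.rank_of_isUnit (pev (t : ℂ) F * (pev (t : ℂ) F)ᴴ)
      ((Matrix.isUnit_iff_isUnit_det _).mpr (isUnit_iff_ne_zero.mpr hne))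
    rw [Matrix.rank_self_mul_conjTranspose, ← Matrix.rank_conjTranspose_mul_self, hpe M F hF t,
      Fintype.card_fin] at h4
    have := hr t
    omega
  obtain ⟨v, hv0, hv⟩ := Matrix.exists_vecMul_eq_zero_iff.mpr hdet
  set w : Matrix (Fin 1) (Fin M) ℂ[X] := Matrix.of fun _ j => v j with hw
  have hw0 : w ≠ 0 := by
    intro h
    apply hv0
    ext1 j
    exact congrFun (congrFun h 0) j
  have hwF : w * (F * Fᴴ) = 0 := by
    ext1 a j
    have := congrFun hv j
    exact this
  have hwF2 : w * F = 0 := by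
    have h5 : (w * F) * (w * F)ᴴ = 0 := by
      rw [Matrix.conjTranspose_mul, ← Matrix.mul_assoc, Matrix.mul_assoc w, hwF, Matrix.zero_mul]
    apply pmat_eq_of_real
    intro t
    have h6 := congrArg (pev (t : ℂ)) h5
    have h0 : ∀ m n : ℕ, pev (t : ℂ) (0 : Matrix (Fin m) (Fin n) ℂ[X]) = 0 := by
      intro m n; ext i j; simp [pev]
    rw [pev_mul, pev_star, h0] at h6
    have : star (t : ℂ) = t := by simp
    rw [this, Matrix.self_mul_conjTranspose_eq_zero] at h6
    rw [h6, h0]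
  obtain ⟨M', hM', Y, hY⟩ := row_reduce (Finset.univ.sup fun j => (w 0 j).natDegree) w hw0 (by
    intro a j
    fin_cases a
    exact Finset.le_sup (f := fun j => (w 0 j).natDegree) (Finset.mem_univ j)) F hwF2
  exact hmin M' hM' ⟨Y, hY.trans hF⟩

theorem real_psd {N r : ℕ} (H : Matrix (Fin N) (Fin N) ℝ) (hH : H.PosSemidef) (hr : H.rank = r) :
    (H.map Complex.ofReal).PosSemidef ∧ (H.map Complex.ofReal).rank = r := by
  obtain ⟨V, D, h1, hD, h2⟩ := psd_factor H hH r hr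
  have hst : Vᴴ.map Complex.ofReal = (V.map Complex.ofReal)ᴴ := by
    ext i j; simp
  have hm : H.map Complex.ofReal = (V.map Complex.ofReal)ᴴ * V.map Complex.ofReal := by
    rw [← h1, ← hst]
    exact Matrix.map_mul (f := Complex.ofRealHom)
  have hm2 : V.map Complex.ofReal * (V.map Complex.ofReal)ᴴ =
      Matrix.diagonal fun i => (D i : ℂ) := by
    rw [← hst]
    have : (V * Vᴴ).map Complex.ofReal = V.map Complex.ofReal * Vᴴ.map Complex.ofReal :=
      Matrix.map_mul (f := Complex.ofRealHom)
    rw [← this, h2]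
    ext i j
    by_cases hij : i = j <;> simp [hij]
  refine ⟨hm ▸ Matrix.posSemidef_conjTranspose_mul_self _, ?_⟩
  rw [hm, Matrix.rank_conjTranspose_mul_self, ← Matrix.rank_self_mul_conjTranspose, hm2,
    Matrix.rank_of_isUnit, Fintype.card_fin]
  rw [Matrix.isUnit_iff_isUnit_det, Matrix.det_diagonal, isUnit_iff_ne_zero,
    Finset.prod_ne_zero_iff]
  intro i _
  exact_mod_cast (hD i).ne'

/-- normalised real factor of the constant term -/
theorem real_factor {N d : ℕ} (H : Matrix (Fin N) (Fin N) ℝ) (hH : H.PosSemidef)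
    (hr : H.rank = d) :
    ∃ (V : Matrix (Fin d) (Fin N) ℝ) (D : Fin d → ℝ), Vᵀ * V = H ∧ (∀ i, 0 < D i) ∧
      V * Vᵀ = Matrix.diagonal D ∧
      (∀ i : Fin d, ∃ j : Fin N, 0 < V i j ∧ ∀ k : Fin N, k < j → V i k = 0) := by
  obtain ⟨V, D, h1, hD, h2⟩ := psd_factor H hH d hr
  rw [Matrix.conjTranspose_eq_transpose_of_trivial] at h1 h2
  have hne : ∀ i, ∃ j, V i j ≠ 0 := by
    intro i
    by_contra hcon
    push Not at hcon
    have := congrFun (congrFun h2 i) i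
    rw [Matrix.mul_apply, Matrix.diagonal_apply_eq] at this
    simp [hcon] at this
    exact (hD i).ne this
  have hfirst : ∀ i, ∃ j, V i j ≠ 0 ∧ ∀ k, k < j → V i k = 0 := by
    intro i
    obtain ⟨j, hj⟩ := hne i
    have hs : (Finset.univ.filter fun j => V i j ≠ 0).Nonempty := ⟨j, by simpa using hj⟩
    refine ⟨_, (Finset.mem_filter.mp (Finset.min'_mem _ hs)).2, ?_⟩
    intro k hk
    by_contra h0
    exact absurd (Finset.min'_le _ k (by simpa using h0)) (not_le.mpr hk)
  choose j hj1 hj2 using hfirst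
  set s : Fin d → ℝ := fun i => SignType.sign (V i (j i)) with hs
  have hss : ∀ i, s i * s i = 1 := by
    intro i
    rcases lt_or_gt_of_ne (hj1 i) with h | h
    · simp [hs, sign_neg h]
    · simp [hs, sign_pos h]
  have hSS : Matrix.diagonal s * Matrix.diagonal s = 1 := by
    rw [Matrix.diagonal_mul_diagonal, ← Matrix.diagonal_one]
    congr 1; ext i; exact hss i
  refine ⟨Matrix.diagonal s * V, D, ?_, hD, ?_, ?_⟩
  · rw [Matrix.transpose_mul, Matrix.diagonal_transpose, Matrix.mul_assoc,
      ← Matrix.mul_assoc _ _ V, hSS, Matrix.one_mul, h1]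
  · rw [Matrix.transpose_mul, Matrix.diagonal_transpose, Matrix.mul_assoc,
      ← Matrix.mul_assoc V, h2, ← Matrix.mul_assoc, Matrix.diagonal_mul_diagonal,
      Matrix.diagonal_mul_diagonal]
    congr 1; ext i
    have := hss i
    simp only [RCLike.ofReal_real_eq_id, id]
    linear_combination D i * this
  · intro i
    refine ⟨j i, ?_, ?_⟩
    · rw [Matrix.diagonal_mul]
      simp only [hs]
      rw [sign_mul_self]
      exact abs_pos.mpr (hj1 i)
    · intro k hk
      rw [Matrix.diagonal_mul, hj2 i k hk, mul_zero]

/-- Lemma 3.1, existence part. Every `G ∈ 𝒢` admits a spectral factor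
`X(t) = Σ_{p=0}^{P} A_p t^p` with `A_p ∈ ℂ^{d×N}` such that `G(t) = X(t)ᴴ X(t)` for all
`t ∈ ℝ`, the constant coefficient `A₀` is real, and `A₀ ∈ 𝒳₀`. -/
theorem stmt5 {d N P : ℕ}
    (B : ℕ → Matrix (Fin N) (Fin N) ℝ)
    (G : ℝ → Matrix (Fin N) (Fin N) ℝ)
    (hG : ∀ t : ℝ, G t = ∑ k ∈ Finset.range (2 * P + 1), t ^ k • B k)
    (hpsd : ∀ t : ℝ, (G t).PosSemidef)
    (hrank : ∀ t : ℝ, (G t).rank ≤ d)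
    (hrank0 : (G 0).rank = d) :
    ∃ A : ℕ → Matrix (Fin d) (Fin N) ℂ,
      (∀ t : ℝ, (polyEvalC P A t)ᴴ * polyEvalC P A t = (G t).map Complex.ofReal) ∧
      (∀ i j, (A 0 i j).im = 0) ∧
      memX0 (Matrix.of fun i j => (A 0 i j).re) := by
  set Gp : Matrix (Fin N) (Fin N) ℂ[X] :=
    Matrix.of fun i j => ∑ k ∈ Finset.range (2 * P + 1), C ((B k i j : ℝ) : ℂ) * X ^ k with hGp
  have hpev : ∀ t : ℝ, pev (t : ℂ) Gp = (G t).map Complex.ofReal := by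
    intro t
    ext i j
    rw [pev_apply, Matrix.map_apply, hG t, Matrix.sum_apply, hGp]
    simp only [Matrix.of_apply, Polynomial.eval_finsetSum, eval_mul, eval_C, eval_pow, eval_X,
      Matrix.smul_apply, smul_eq_mul]
    push_cast
    exact Finset.sum_congr rfl fun k _ => mul_comm _ _
  have hdeg : ∀ i j, (Gp i j).natDegree ≤ 2 * P := by
    intro i j
    rw [hGp, Matrix.of_apply]
    apply Polynomial.natDegree_sum_le_of_forall_le
    intro k hk
    refine (Polynomial.natDegree_C_mul_X_pow_le _ _).trans ?_
    have := Finset.mem_range.mp hk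
    omega
  obtain ⟨F, hF⟩ := exists_factor (d := d) Gp
    (fun t => by rw [hpev]; exact (real_psd _ (hpsd t) rfl).1)
    (fun t => by rw [hpev, (real_psd _ (hpsd t) rfl).2]; exact hrank t)
    (by rw [hpev]; exact (real_psd _ (hpsd 0) hrank0).2)
  have hFdeg : ∀ i j, (F i j).natDegree ≤ P := by
    intro i j
    refine degree_bound (fun i => F i j) P ?_ i
    have := hdeg j j
    rw [← hF, Matrix.mul_apply] at this
    exact this
  have hFt : ∀ t : ℝ, (pev (t : ℂ) F)ᴴ * pev (t : ℂ) F = (G t).map Complex.ofReal := by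
    intro t
    rw [← hpev, ← hF, pev_mul, pev_star]
    simp
  obtain ⟨V, D, hV1, hD, hV2, hV3⟩ := real_factor (G 0) (hpsd 0) hrank0
  set W : Matrix (Fin d) (Fin N) ℂ := V.map Complex.ofReal with hW
  have hst : Vᵀ.map Complex.ofReal = Wᴴ := by
    ext i j; simp [hW]
  have hW1 : Wᴴ * W = (G 0).map Complex.ofReal := by
    rw [← hV1, ← hst]
    exact (Matrix.map_mul (f := Complex.ofRealHom)).symm
  have hW2 : W * Wᴴ = Matrix.diagonal fun i => (D i : ℂ) := by
    rw [← hst]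
    have : (V * Vᵀ).map Complex.ofReal = V.map Complex.ofReal * Vᵀ.map Complex.ofReal :=
      Matrix.map_mul (f := Complex.ofRealHom)
    rw [hW, ← this, hV2]
    ext i j
    by_cases hij : i = j <;> simp [hij]
  set E : Matrix (Fin d) (Fin d) ℂ := Matrix.diagonal (fun i => ((D i)⁻¹ : ℂ)) with hE
  have hDi : ∀ i, (D i : ℂ) ≠ 0 := fun i => by exact_mod_cast (hD i).ne'
  have hEW : E * (W * Wᴴ) = 1 := by
    rw [hW2, hE, Matrix.diagonal_mul_diagonal, ← Matrix.diagonal_one]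
    congr 1
    ext i
    simpa using inv_mul_cancel₀ (hDi i)
  have hEH : Eᴴ = E := by
    rw [hE, Matrix.diagonal_conjTranspose]
    congr 1
    ext i
    simp
  have hWE : (W * Wᴴ) * E = 1 := mul_eq_one_comm.mp hEW
  set A0 := pev ((0 : ℝ) : ℂ) F with hA0
  have hA0A : A0ᴴ * A0 = Wᴴ * W := by rw [hW1]; exact hFt 0
  set U := E * W * A0ᴴ with hU
  have hUA : U * A0 = W := by
    rw [hU, Matrix.mul_assoc, hA0A, Matrix.mul_assoc, ← Matrix.mul_assoc W, ← Matrix.mul_assoc,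
      hEW, Matrix.one_mul]
  have hUU : U * Uᴴ = 1 := by
    have : Uᴴ = A0 * Wᴴ * E := by
      rw [hU]; simp [Matrix.conjTranspose_mul, hEH, Matrix.mul_assoc]
    rw [this, ← Matrix.mul_assoc, ← Matrix.mul_assoc, hUA, hWE]
  have hUU' : Uᴴ * U = 1 := mul_eq_one_comm.mp hUU
  set Y := pcn U * F with hY
  have hYdeg : ∀ i j, (Y i j).natDegree < P + 1 := by
    intro i j
    rw [Nat.lt_succ_iff, hY, Matrix.mul_apply]
    apply Polynomial.natDegree_sum_le_of_forall_le
    intro x _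
    simp only [pcn, Matrix.map_apply]
    exact (Polynomial.natDegree_C_mul_le _ _).trans (hFdeg x j)
  set A : ℕ → Matrix (Fin d) (Fin N) ℂ := fun p => Matrix.of fun i j => (Y i j).coeff p with hA
  have hYA : ∀ t : ℝ, polyEvalC P A t = pev (t : ℂ) Y := by
    intro t
    ext i j
    rw [polyEvalC, Matrix.sum_apply, pev_apply, Polynomial.eval_eq_sum_range' (hYdeg i j)]
    exact Finset.sum_congr rfl fun k _ => mul_comm _ _
  have hA00 : A 0 = W := by
    rw [← hUA, hA0]
    have : A 0 = pev ((0 : ℝ) : ℂ) Y := by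
      ext i j
      simp [hA, pev_apply, Polynomial.coeff_zero_eq_eval_zero]
    rw [this, hY, pev_mul, pev_pcn]
  have hre : (Matrix.of fun i j => (A 0 i j).re) = V := by
    rw [hA00]; ext i j; simp [hW]
  refine ⟨A, ?_, ?_, ?_⟩
  · intro t
    rw [hYA, hY, pev_mul, pev_pcn, Matrix.conjTranspose_mul, Matrix.mul_assoc,
      ← Matrix.mul_assoc Uᴴ, hUU', Matrix.one_mul, hFt]
  · intro i j
    rw [hA00]; simp [hW]
  · rw [hre]
    refine ⟨?_, hV3⟩
    intro i i' hii
    have := congrFun (congrFun hV2 i) i'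
    rw [Matrix.diagonal_apply_ne _ hii] at this
    exact this
end

section
/- Let P ≥ 1 and let X(t) = Σ_{p=0}^{P} A_p t^p with A_p ∈ ℂ^{d×N}, A_p = R_p + i Q_p, Q₀ = 0, and rank R₀ = d. If the Gramian X(t)ᴴ X(t) has real coefficients, then there exists a symmetric matrix W₁ ∈ ℝ^{d×d} such that Q₁ = W₁ R₀. -/
open Matrix Finset

/-- The real polynomial with coefficients `a 0, …, a P`. -/
noncomputable def auxPoly (P : ℕ) (a : ℕ → ℝ) : Polynomial ℝ :=
  ∑ p ∈ Finset.range (P + 1), Polynomial.C (a p) * Polynomial.X ^ p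

lemma auxPoly_coeff (P : ℕ) (a : ℕ → ℝ) (n : ℕ) (hn : n ≤ P) : (auxPoly P a).coeff n = a n := by
  simp only [auxPoly, Polynomial.finsetSum_coeff, Polynomial.coeff_C_mul_X_pow]
  rw [Finset.sum_ite_eq, if_pos]
  simp; omega

lemma auxPoly_eval (P : ℕ) (a b : ℕ → ℝ) (t : ℝ) :
    ∑ p ∈ Finset.range (P + 1), (t : ℂ) ^ p * ((a p : ℂ) + Complex.I * (b p : ℂ)) =
      (((auxPoly P a).eval t : ℝ) : ℂ) + Complex.I * (((auxPoly P b).eval t : ℝ) : ℂ) := by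
  simp only [auxPoly, Polynomial.eval_finsetSum, Polynomial.eval_mul, Polynomial.eval_C,
    Polynomial.eval_pow, Polynomial.eval_X]
  push_cast
  rw [Finset.mul_sum, ← Finset.sum_add_distrib]
  refine Finset.sum_congr rfl fun p _ => ?_
  ring

/-- induction base in the proof of Theorem 3.2. Let `P ≥ 1` and let
`X(t) = Σ_{p=0}^{P} A_p t^p` with `A_p = R_p + i Q_p`, `Q₀ = 0`, and `rank R₀ = d`. If the
Gramian `X(t)ᴴ X(t)` has real coefficients, then there is a symmetric `W₁ ∈ ℝ^{d×d}` with
`Q₁ = W₁ R₀`. -/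
theorem stmt6 {d N P : ℕ} (hP : 1 ≤ P)
    (R Q : ℕ → Matrix (Fin d) (Fin N) ℝ)
    (A : ℕ → Matrix (Fin d) (Fin N) ℂ)
    (hA : ∀ p, A p = (R p).map Complex.ofReal + Complex.I • (Q p).map Complex.ofReal)
    (hQ0 : Q 0 = 0) (hR0 : (R 0).rank = d)
    (hreal : ∀ t : ℝ, ∀ i j, (((polyEvalC P A t)ᴴ * polyEvalC P A t) i j).im = 0) :
    ∃ W1 : Matrix (Fin d) (Fin d) ℝ, W1.IsSymm ∧ Q 1 = W1 * R 0 := by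
  have hX : ∀ (t : ℝ) k i, polyEvalC P A t k i =
      (((auxPoly P (fun p => R p k i)).eval t : ℝ) : ℂ) +
        Complex.I * (((auxPoly P (fun p => Q p k i)).eval t : ℝ) : ℂ) := by
    intro t k i
    rw [← auxPoly_eval]
    simp [polyEvalC, Matrix.sum_apply, hA, mul_add]
  have key : (R 0)ᵀ * Q 1 = (Q 1)ᵀ * R 0 := by
    ext i j
    have hF : (∑ k, (auxPoly P (fun p => R p k i) * auxPoly P (fun p => Q p k j) -
        auxPoly P (fun p => Q p k i) * auxPoly P (fun p => R p k j))) = 0 := by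
      apply Polynomial.funext
      intro t
      have h := hreal t i j
      simp only [Matrix.mul_apply, Matrix.conjTranspose_apply, hX, Complex.im_sum] at h
      rw [Polynomial.eval_finsetSum, Polynomial.eval_zero, ← h]
      refine Finset.sum_congr rfl fun k _ => ?_
      simp
      ring
    have h1 := congrArg (fun f => Polynomial.coeff f 1) hF
    simp only [Polynomial.finsetSum_coeff, Polynomial.coeff_sub, Polynomial.mul_coeff_one,
      Polynomial.coeff_zero, auxPoly_coeff _ _ 0 (Nat.zero_le P), auxPoly_coeff _ _ 1 hP, hQ0,
      Matrix.zero_apply, zero_mul, mul_zero, add_zero, zero_add, Finset.sum_sub_distrib] at h1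
    simp only [Matrix.mul_apply, Matrix.transpose_apply]
    linarith
  have hsurj : Function.Surjective (R 0).mulVec := by
    have h : LinearMap.range (R 0).mulVecLin = ⊤ := by
      apply Submodule.eq_top_of_finrank_eq
      rw [← Matrix.rank, hR0]; simp
    exact LinearMap.range_eq_top.mp h
  obtain ⟨B, hB⟩ := Matrix.mulVec_surjective_iff_exists_right_inverse.mp hsurj
  have hB' : Bᵀ * (R 0)ᵀ = 1 := by rw [← Matrix.transpose_mul, hB, Matrix.transpose_one]
  have hQ : Q 1 = (Bᵀ * (Q 1)ᵀ) * R 0 := by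
    rw [Matrix.mul_assoc, ← key, ← Matrix.mul_assoc, hB', Matrix.one_mul]
  have hW : Q 1 * B = Bᵀ * (Q 1)ᵀ := by
    calc Q 1 * B = (Bᵀ * (Q 1)ᵀ) * R 0 * B := by rw [← hQ]
      _ = _ := by rw [Matrix.mul_assoc, hB, Matrix.mul_one]
  refine ⟨Bᵀ * (Q 1)ᵀ, ?_, hQ⟩
  rw [Matrix.IsSymm, Matrix.transpose_mul, Matrix.transpose_transpose, Matrix.transpose_transpose,
    hW]
end

section
/- Let P ≥ 1 and let X(t) = Σ_{p=0}^{P} A_p t^p with A_p ∈ ℂ^{d×N}, A_p = R_p + i Q_p, Q₀ = 0, and rank R₀ = d. If the Gramian X(t)ᴴ X(t) has real coefficients, then there exist symmetric matrices W₁,…,W_{2P} ∈ ℝ^{d×d} such that Q_p = Σ_{j=1}^{p} W_j R_{p−j} for every p ∈ {1,…,P}, and Σ_{i=0}^{P} W_{P+p−i} R_i = 0 for every p ∈ {1,…,P}. -/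
open Matrix Finset

/-- The `(i,j)` entry of the truncated polynomial matrix. -/
noncomputable def truncPoly {d N : ℕ} (P : ℕ) (R : ℕ → Matrix (Fin d) (Fin N) ℝ) :
    Matrix (Fin d) (Fin N) (Polynomial ℝ) :=
  fun i j => ∑ p ∈ Finset.range (P + 1), Polynomial.monomial p (R p i j)

theorem truncPoly_coeff {d N : ℕ} (P : ℕ) (R : ℕ → Matrix (Fin d) (Fin N) ℝ) (i j) (n : ℕ) :
    (truncPoly P R i j).coeff n = if n ≤ P then R n i j else 0 := by
  simp [truncPoly, Polynomial.finsetSum_coeff, Polynomial.coeff_monomial]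

theorem truncPoly_eval {d N : ℕ} (P : ℕ) (R : ℕ → Matrix (Fin d) (Fin N) ℝ) (i j) (t : ℝ) :
    (truncPoly P R i j).eval t = ∑ p ∈ Finset.range (P + 1), t ^ p * R p i j := by
  simp [truncPoly, Polynomial.eval_finsetSum, mul_comm]

theorem polyEvalC_apply {d N P : ℕ}
    (R Q : ℕ → Matrix (Fin d) (Fin N) ℝ)
    (A : ℕ → Matrix (Fin d) (Fin N) ℂ)
    (hA : ∀ p, A p = (R p).map Complex.ofReal + Complex.I • (Q p).map Complex.ofReal)
    (t : ℝ) (i j) : polyEvalC P A t i j =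
      (((truncPoly P R i j).eval t : ℝ) : ℂ) + Complex.I * (((truncPoly P Q i j).eval t : ℝ) : ℂ) := by
  rw [truncPoly_eval, truncPoly_eval, polyEvalC, Matrix.sum_apply]
  push_cast
  rw [Finset.mul_sum, ← Finset.sum_add_distrib]
  refine Finset.sum_congr rfl fun p _ => ?_
  simp [hA]
  ring

theorem truncPoly_comm {d N P : ℕ}
    (R Q : ℕ → Matrix (Fin d) (Fin N) ℝ)
    (A : ℕ → Matrix (Fin d) (Fin N) ℂ)
    (hA : ∀ p, A p = (R p).map Complex.ofReal + Complex.I • (Q p).map Complex.ofReal)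
    (hreal : ∀ t : ℝ, ∀ i j, (((polyEvalC P A t)ᴴ * polyEvalC P A t) i j).im = 0) :
    (truncPoly P R)ᵀ * truncPoly P Q = (truncPoly P Q)ᵀ * truncPoly P R := by
  ext1 i j
  apply Polynomial.funext
  intro t
  have h := hreal t i j
  rw [Matrix.mul_apply, Complex.im_sum] at h
  rw [Matrix.mul_apply, Matrix.mul_apply, Polynomial.eval_finsetSum, Polynomial.eval_finsetSum,
    ← sub_eq_zero, ← Finset.sum_sub_distrib, ← h]
  refine Finset.sum_congr rfl fun k _ => ?_
  rw [Matrix.conjTranspose_apply, polyEvalC_apply R Q A hA, polyEvalC_apply R Q A hA]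
  simp
  ring

theorem exists_rightInv {d N : ℕ} (M : Matrix (Fin d) (Fin N) ℝ) (h : M.rank = d) :
    ∃ B : Matrix (Fin N) (Fin d) ℝ, M * B = 1 := by
  rw [← Matrix.mulVec_surjective_iff_exists_right_inverse]
  have h2 : LinearMap.range M.mulVecLin = ⊤ := by
    apply Submodule.eq_top_of_finrank_eq
    rw [← Matrix.rank, h]; simp
  exact LinearMap.range_eq_top.mp h2

/-- Abstract factorisation. -/
theorem factor_aux {K : Type*} [CommRing K] {d N : ℕ} (R Q : Matrix (Fin d) (Fin N) K)
    (B : Matrix (Fin N) (Fin d) K) (hS : IsUnit (R * B).det) (h : Rᵀ * Q = Qᵀ * R) :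
    ∃ W : Matrix (Fin d) (Fin d) K, Wᵀ = W ∧ Q = W * R ∧ W = Q * (B * (R * B)⁻¹) := by
  have hS' : IsUnit ((R * B)ᵀ).det := by rwa [Matrix.det_transpose]
  have h1 : (R * B)ᵀ * Q = (Q * B)ᵀ * R := by
    rw [Matrix.transpose_mul, Matrix.transpose_mul, Matrix.mul_assoc, Matrix.mul_assoc, h]
  have h2 : Q = ((R * B)ᵀ)⁻¹ * (Q * B)ᵀ * R := by
    rw [Matrix.mul_assoc, ← h1, Matrix.nonsing_inv_mul_cancel_left _ _ hS']
  have h3 : ((R * B)ᵀ)⁻¹ * (Q * B)ᵀ = Q * (B * (R * B)⁻¹) := by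
    conv_rhs => rw [h2]
    rw [Matrix.mul_assoc _ R, ← Matrix.mul_assoc R, Matrix.mul_nonsing_inv _ hS, Matrix.mul_one]
  refine ⟨((R * B)ᵀ)⁻¹ * (Q * B)ᵀ, ?_, h2, h3⟩
  conv_rhs => rw [h3]
  rw [Matrix.transpose_mul, Matrix.transpose_transpose, Matrix.transpose_nonsing_inv,
    Matrix.transpose_transpose, Matrix.mul_assoc]

/-- structure of spectral factors, Theorem 3.2, necessity part. Let `P ≥ 1`
and let `X(t) = Σ_{p=0}^{P} A_p t^p` with `A_p = R_p + i Q_p`, `Q₀ = 0`, and `rank R₀ = d`.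
If the Gramian `X(t)ᴴ X(t)` has real coefficients, then there exist symmetric matrices
`W₁, …, W_{2P} ∈ ℝ^{d×d}` such that `Q_p = Σ_{j=1}^{p} W_j R_{p−j}` for every `p ∈ {1,…,P}`
and `Σ_{i=0}^{P} W_{P+p−i} R_i = 0` for every `p ∈ {1,…,P}`. -/
theorem stmt7 {d N P : ℕ} (hP : 1 ≤ P)
    (R Q : ℕ → Matrix (Fin d) (Fin N) ℝ)
    (A : ℕ → Matrix (Fin d) (Fin N) ℂ)
    (hA : ∀ p, A p = (R p).map Complex.ofReal + Complex.I • (Q p).map Complex.ofReal)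
    (hQ0 : Q 0 = 0) (hR0 : (R 0).rank = d)
    (hreal : ∀ t : ℝ, ∀ i j, (((polyEvalC P A t)ᴴ * polyEvalC P A t) i j).im = 0) :
    ∃ W : ℕ → Matrix (Fin d) (Fin d) ℝ,
      (∀ k ∈ Finset.Icc 1 (2 * P), (W k).IsSymm) ∧
      (∀ p ∈ Finset.Icc 1 P, Q p = ∑ j ∈ Finset.Icc 1 p, W j * R (p - j)) ∧
      (∀ p ∈ Finset.Icc 1 P, ∑ i ∈ Finset.range (P + 1), W (P + p - i) * R i = 0) := by
  obtain ⟨B, hB⟩ := exists_rightInv (R 0) hR0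
  let φ : Polynomial ℝ →+* PowerSeries ℝ := Polynomial.coeToPowerSeries.ringHom
  let ε : PowerSeries ℝ →+* ℝ := PowerSeries.constantCoeff
  set R' : Matrix (Fin d) (Fin N) (PowerSeries ℝ) := (truncPoly P R).map φ with hR'
  set Q' : Matrix (Fin d) (Fin N) (PowerSeries ℝ) := (truncPoly P Q).map φ with hQ'
  have hRc : ∀ n i j, PowerSeries.coeff n (R' i j) = if n ≤ P then R n i j else 0 := by
    intro n i j
    rw [← truncPoly_coeff]
    simp [hR', φ]
  have hQc : ∀ n i j, PowerSeries.coeff n (Q' i j) = if n ≤ P then Q n i j else 0 := by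
    intro n i j
    rw [← truncPoly_coeff]
    simp [hQ', φ]
  have hcomm : R'ᵀ * Q' = Q'ᵀ * R' := by
    have := congrArg (fun M => M.map φ) (truncPoly_comm R Q A hA hreal)
    simp only [Matrix.map_mul] at this
    exact this
  let B' : Matrix (Fin N) (Fin d) (PowerSeries ℝ) := B.map PowerSeries.C
  have hRε : R'.map ε = R 0 := by
    ext i j
    have := hRc 0 i j
    simpa [ε] using this
  have hQε : Q'.map ε = 0 := by
    ext i j
    have := hQc 0 i j
    simpa [ε, hQ0] using this
  have hBε : B'.map ε = B := by
    ext i j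
    simp [ε, B']
  have hS : IsUnit (R' * B').det := by
    rw [PowerSeries.isUnit_iff_constantCoeff]
    have : ε (R' * B').det = 1 := by
      rw [RingHom.map_det, RingHom.mapMatrix_apply, Matrix.map_mul, hRε, hBε, hB, Matrix.det_one]
    change IsUnit (ε (R' * B').det)
    rw [this]
    exact isUnit_one
  obtain ⟨W, hWs, hWR, hWQ⟩ := factor_aux R' Q' B' hS hcomm
  have hW0 : ∀ i j, PowerSeries.coeff 0 (W i j) = 0 := by
    intro i j
    have h : W.map ε = 0 := by
      rw [hWQ, Matrix.map_mul, hQε, Matrix.zero_mul]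
    have := congrFun (congrFun h i) j
    simpa [ε] using this
  have key : ∀ n, (if n ≤ P then Q n else 0) = ∑ q ∈ Finset.range (n + 1),
      (W.map (PowerSeries.coeff (n - q))) * (if q ≤ P then R q else 0) := by
    intro n
    ext i j
    have h1 := hQc n i j
    rw [hWR, Matrix.mul_apply, map_sum] at h1
    have h2 : (if n ≤ P then Q n else 0) i j = if n ≤ P then Q n i j else 0 := by
      split_ifs <;> rfl
    rw [h2, ← h1, Matrix.sum_apply]
    simp only [Matrix.mul_apply]
    rw [Finset.sum_comm]
    refine Finset.sum_congr rfl fun k _ => ?_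
    rw [mul_comm, PowerSeries.coeff_mul, Finset.Nat.sum_antidiagonal_eq_sum_range_succ_mk]
    refine Finset.sum_congr rfl fun q _ => ?_
    rw [hRc, mul_comm]
    simp only [Matrix.map_apply]
    congr 1
    split_ifs <;> rfl
  have hWz : W.map (PowerSeries.coeff 0) = 0 := by
    ext i j
    simpa using hW0 i j
  refine ⟨fun n => W.map (PowerSeries.coeff n), ?_, ?_, ?_⟩
  · intro k _
    change (Wᵀ).map (PowerSeries.coeff k) = W.map (PowerSeries.coeff k)
    rw [hWs]
  · intro p hp
    rw [Finset.mem_Icc] at hp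
    have h := key p
    rw [if_pos hp.2, ← Finset.sum_range_reflect, Finset.sum_range_succ'] at h
    rw [h, Finset.range_eq_Ico, Finset.sum_Ico_add' (fun k => W.map (PowerSeries.coeff
      (p - (p + 1 - 1 - k))) * if p + 1 - 1 - k ≤ P then R (p + 1 - 1 - k) else 0) 0 p 1]
    simp only [Nat.add_sub_cancel, Nat.sub_zero, Nat.sub_self, hWz, Matrix.zero_mul, add_zero]
    have hI : Finset.Ico (0 + 1) (p + 1) = Finset.Icc 1 p := by
      ext x; simp only [Finset.mem_Ico, Finset.mem_Icc]; omega
    rw [hI]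
    refine Finset.sum_congr rfl fun k hk => ?_
    rw [Finset.mem_Icc] at hk
    rw [if_pos (by omega), show p - (p - k) = k by omega]
  · intro p hp
    rw [Finset.mem_Icc] at hp
    have h := key (P + p)
    rw [if_neg (by omega)] at h
    rw [h]
    symm
    rw [← Finset.sum_subset (Finset.range_mono (show P + 1 ≤ P + p + 1 by omega))]
    · refine Finset.sum_congr rfl fun k hk => ?_
      rw [Finset.mem_range] at hk
      rw [if_pos (by omega)]
    · intro k _ hk
      rw [Finset.mem_range] at hk
      rw [if_neg (by omega), Matrix.mul_zero]
end

section
/- Let P ≥ 1, let R₀,…,R_P ∈ ℝ^{d×N} with rank R₀ = d, and let W₁,…,W_{2P} and W₁′,…,W_{2P}′ be symmetric matrices in ℝ^{d×d}. Suppose both families satisfy Σ_{j=1}^{p} W_j R_{p−j} = Σ_{j=1}^{p} W_j′ R_{p−j} for every p ∈ {1,…,P}, and each family satisfies Σ_{i=0}^{P} W_{P+p−i} R_i = 0 and Σ_{i=0}^{P} W_{P+p−i}′ R_i = 0 for every p ∈ {1,…,P}. Then W_k = W_k′ for every k ∈ {1,…,2P}. -/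
open Matrix Finset

/-- uniqueness of the representation `(\{W_k\}, \{R_p\})`, Theorem 3.2.
Let `P ≥ 1`, `R₀, …, R_P ∈ ℝ^{d×N}` with `rank R₀ = d`, and let `W₁,…,W_{2P}` and
`W₁′,…,W_{2P}′` be symmetric `d × d` matrices. If both families produce the same imaginary
parts `Σ_{j=1}^{p} W_j R_{p−j}` for `p ∈ {1,…,P}` and each satisfies
`Σ_{i=0}^{P} W_{P+p−i} R_i = 0` for `p ∈ {1,…,P}`, then `W_k = W_k′` for all `k ∈ {1,…,2P}`. -/
theorem stmt8 {d N P : ℕ} (hP : 1 ≤ P)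
    (R : ℕ → Matrix (Fin d) (Fin N) ℝ) (hR0 : (R 0).rank = d)
    (W W' : ℕ → Matrix (Fin d) (Fin d) ℝ)
    (hWsymm : ∀ k ∈ Finset.Icc 1 (2 * P), (W k).IsSymm)
    (hW'symm : ∀ k ∈ Finset.Icc 1 (2 * P), (W' k).IsSymm)
    (hQ : ∀ p ∈ Finset.Icc 1 P,
      ∑ j ∈ Finset.Icc 1 p, W j * R (p - j) = ∑ j ∈ Finset.Icc 1 p, W' j * R (p - j))
    (hWX : ∀ p ∈ Finset.Icc 1 P, ∑ i ∈ Finset.range (P + 1), W (P + p - i) * R i = 0)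
    (hWX' : ∀ p ∈ Finset.Icc 1 P, ∑ i ∈ Finset.range (P + 1), W' (P + p - i) * R i = 0) :
    ∀ k ∈ Finset.Icc 1 (2 * P), W k = W' k := by
  have hcancel : ∀ A B : Matrix (Fin d) (Fin d) ℝ, A * R 0 = B * R 0 → A = B := by
    intro A B h
    have hr : (R 0 * (R 0)ᵀ).rank = Fintype.card (Fin d) := by
      rw [Matrix.rank_self_mul_transpose, hR0, Fintype.card_fin]
    have hu : IsUnit (R 0 * (R 0)ᵀ) := by
      rw [← Matrix.linearIndependent_rows_iff_isUnit, linearIndependent_iff_card_eq_finrank_span,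
        ← hr, Matrix.rank_eq_finrank_span_row]
      rfl
    apply hu.mul_right_cancel
    rw [← Matrix.mul_assoc, ← Matrix.mul_assoc, h]
  intro k
  induction k using Nat.strong_induction_on with
  | _ k ih =>
    intro hk
    rw [Finset.mem_Icc] at hk
    apply hcancel
    by_cases hkP : k ≤ P
    · have h := hQ k (Finset.mem_Icc.2 ⟨hk.1, hkP⟩)
      obtain ⟨m, rfl⟩ : ∃ m, k = m + 1 := ⟨k - 1, by omega⟩
      rw [Finset.sum_Icc_succ_top (by omega), Finset.sum_Icc_succ_top (by omega)] at h
      have e : ∑ j ∈ Finset.Icc 1 m, W j * R (m + 1 - j)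
          = ∑ j ∈ Finset.Icc 1 m, W' j * R (m + 1 - j) := by
        apply Finset.sum_congr rfl
        intro j hj
        rw [Finset.mem_Icc] at hj
        rw [ih j (by omega) (Finset.mem_Icc.2 ⟨hj.1, by omega⟩)]
      rw [e] at h
      simpa using h
    · have hp : k - P ∈ Finset.Icc 1 P := Finset.mem_Icc.2 ⟨by omega, by omega⟩
      have h := (hWX _ hp).trans (hWX' _ hp).symm
      rw [show P + (k - P) = k by omega, Finset.sum_range_succ', Finset.sum_range_succ'] at h
      have e : ∑ i ∈ Finset.range P, W (k - (i + 1)) * R (i + 1)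
          = ∑ i ∈ Finset.range P, W' (k - (i + 1)) * R (i + 1) := by
        apply Finset.sum_congr rfl
        intro i hi
        rw [Finset.mem_range] at hi
        rw [ih (k - (i + 1)) (by omega) (Finset.mem_Icc.2 ⟨by omega, by omega⟩)]
      rw [e] at h
      simpa using h
end

section
/- Let P ≥ 1, let W₁,…,W_{2P} ∈ ℝ^{d×d} be symmetric matrices and R₀,…,R_P ∈ ℝ^{d×N} matrices satisfying equation (WX). Define A₀,…,A_P ∈ ℂ^{d×N} by equation (A_WX), and set X(t) = Σ_{p=0}^{P} A_p t^p. Then the Gramian X(t)ᴴ X(t) has real coefficients. -/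
open Matrix Finset

lemma aux_sym {d N : ℕ} (W : ℕ → Matrix (Fin d) (Fin d) ℝ) (R : ℕ → Matrix (Fin d) (Fin N) ℝ)
    (hW : ∀ k, (W k)ᵀ = W k) (m : ℕ) :
    (∑ x ∈ antidiagonal m, (R x.1)ᵀ * ∑ y ∈ antidiagonal x.2, W y.1 * R y.2)ᵀ =
      ∑ x ∈ antidiagonal m, (R x.1)ᵀ * ∑ y ∈ antidiagonal x.2, W y.1 * R y.2 := by
  simp only [Matrix.mul_sum, Matrix.transpose_sum, Matrix.transpose_mul, hW,
    Matrix.transpose_transpose]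
  rw [Finset.sum_sigma', Finset.sum_sigma']
  refine Finset.sum_nbij' (fun z => ⟨(z.2.2, z.2.1 + z.1.1), (z.2.1, z.1.1)⟩)
    (fun z => ⟨(z.2.2, z.2.1 + z.1.1), (z.2.1, z.1.1)⟩) ?_ ?_ ?_ ?_ ?_
  · rintro ⟨⟨a, b⟩, ⟨c, e⟩⟩ h
    simp at h ⊢
    omega
  · rintro ⟨⟨a, b⟩, ⟨c, e⟩⟩ h
    simp at h ⊢
    omega
  · rintro ⟨⟨a, b⟩, ⟨c, e⟩⟩ h
    simp at h ⊢
    omega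
  · rintro ⟨⟨a, b⟩, ⟨c, e⟩⟩ h
    simp at h ⊢
    omega
  · rintro ⟨⟨a, b⟩, ⟨c, e⟩⟩ h
    simp [Matrix.mul_assoc]

lemma aux_box {M : Type*} [AddCommMonoid M] (P : ℕ) (g : ℕ → ℕ → M)
    (hg : ∀ i n, i + n ≤ 2 * P → (P < i ∨ P < n) → g i n = 0) :
    ∑ i ∈ range (P + 1), ∑ n ∈ range (P + 1), g i n =
      ∑ m ∈ range (2 * P + 1), ∑ x ∈ antidiagonal m, g x.1 x.2 := by
  rw [← Finset.sum_product', ← Finset.sum_fiberwise_of_maps_to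
    (s := range (P + 1) ×ˢ range (P + 1)) (t := range (2 * P + 1)) (g := fun x => x.1 + x.2)]
  · refine Finset.sum_congr rfl fun m hm => ?_
    refine Finset.sum_subset ?_ ?_
    · intro x hx
      simp at hx ⊢
      exact hx.2
    · rintro ⟨a, b⟩ h1 h2
      simp at h1 h2 hm
      apply hg <;> omega
  · rintro ⟨a, b⟩ h
    simp at h ⊢
    omega

lemma aux_real {d N P : ℕ}
    (W : ℕ → Matrix (Fin d) (Fin d) ℝ)
    (R : ℕ → Matrix (Fin d) (Fin N) ℝ)
    (hWsymm : ∀ k ∈ Finset.Icc 1 (2 * P), (W k).IsSymm)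
    (hWX : ∀ p ∈ Finset.Icc 1 P, ∑ i ∈ Finset.range (P + 1), W (P + p - i) * R i = 0)
    (t : ℝ) :
    ((∑ p ∈ range (P + 1), t ^ p • R p)ᵀ *
      ∑ p ∈ range (P + 1), t ^ p • ∑ j ∈ Finset.Icc 1 p, W j * R (p - j)).IsSymm := by
  set R' : ℕ → Matrix (Fin d) (Fin N) ℝ := fun a => if a ≤ P then R a else 0 with hR'
  set W' : ℕ → Matrix (Fin d) (Fin d) ℝ := fun k => if 1 ≤ k ∧ k ≤ 2 * P then W k else 0 with hW'
  have hs : ∀ k, (W' k)ᵀ = W' k := by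
    intro k
    by_cases h : 1 ≤ k ∧ k ≤ 2 * P
    · simp only [hW', if_pos h]
      exact hWsymm k (by simpa using h)
    · simp only [hW', if_neg h, Matrix.transpose_zero]
  have hS : ∀ n ≤ P, ∑ j ∈ Finset.Icc 1 n, W j * R (n - j) =
      ∑ y ∈ antidiagonal n, W' y.1 * R' y.2 := by
    intro n hn
    rw [Finset.Nat.sum_antidiagonal_eq_sum_range_succ (fun a b => W' a * R' b)]
    have hsub : Finset.Icc 1 n ⊆ range n.succ := by
      intro x hx; simp at hx ⊢; omega
    rw [← Finset.sum_subset hsub]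
    · refine Finset.sum_congr rfl fun j hj => ?_
      simp at hj
      simp only [hW', hR']
      rw [if_pos (by omega), if_pos (by omega)]
    · intro x h1 h2
      simp at h1 h2
      simp only [hW']
      rw [if_neg (by omega), Matrix.zero_mul]
  have hS0 : ∀ n, P < n → n ≤ 2 * P → ∑ y ∈ antidiagonal n, W' y.1 * R' y.2 = 0 := by
    intro n hn hn2
    rw [← Finset.Nat.sum_antidiagonal_swap]
    simp only [Prod.fst_swap, Prod.snd_swap]
    rw [Finset.Nat.sum_antidiagonal_eq_sum_range_succ (fun a b => W' b * R' a)]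
    rw [← hWX (n - P) (by simp; omega)]
    have hsub : range (P + 1) ⊆ range n.succ := by
      intro x hx; simp at hx ⊢; omega
    rw [← Finset.sum_subset hsub]
    · refine Finset.sum_congr rfl fun j hj => ?_
      simp at hj
      simp only [hW', hR']
      rw [if_pos (by omega), if_pos (by omega), show P + (n - P) - j = n - j by omega]
    · intro x h1 h2
      simp at h1 h2
      simp only [hR']
      rw [if_neg (by omega), Matrix.mul_zero]
  have key : (∑ p ∈ range (P + 1), t ^ p • R p)ᵀ *
      ∑ p ∈ range (P + 1), t ^ p • ∑ j ∈ Finset.Icc 1 p, W j * R (p - j) =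
      ∑ m ∈ range (2 * P + 1), t ^ m • ∑ x ∈ antidiagonal m,
        (R' x.1)ᵀ * ∑ y ∈ antidiagonal x.2, W' y.1 * R' y.2 := by
    have h1 : (∑ p ∈ range (P + 1), t ^ p • R p)ᵀ *
      ∑ p ∈ range (P + 1), t ^ p • ∑ j ∈ Finset.Icc 1 p, W j * R (p - j) =
      ∑ i ∈ range (P + 1), ∑ n ∈ range (P + 1),
        t ^ (i + n) • ((R' i)ᵀ * ∑ y ∈ antidiagonal n, W' y.1 * R' y.2) := by
      rw [Matrix.transpose_sum, Matrix.sum_mul]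
      refine Finset.sum_congr rfl fun i hi => ?_
      rw [Matrix.mul_sum]
      refine Finset.sum_congr rfl fun n hn => ?_
      simp at hi hn
      rw [hS n (by omega), Matrix.transpose_smul, Matrix.smul_mul, Matrix.mul_smul, smul_smul,
        pow_add]
      simp only [hR']
      rw [if_pos (show i ≤ P by omega)]
    rw [h1, aux_box P (fun i n => t ^ (i + n) •
      ((R' i)ᵀ * ∑ y ∈ antidiagonal n, W' y.1 * R' y.2))]
    · refine Finset.sum_congr rfl fun m hm => ?_
      rw [Finset.smul_sum]
      refine Finset.sum_congr rfl fun x hx => ?_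
      rw [mem_antidiagonal.1 hx]
    · intro i n h h'
      by_cases hi : P < i
      · have : R' i = 0 := by simp only [hR']; rw [if_neg (by omega)]
        simp [this]
      · rw [hS0 n (by omega) (by omega)]
        simp
  rw [key, Matrix.IsSymm, Matrix.transpose_sum]
  refine Finset.sum_congr rfl fun m _ => ?_
  rw [Matrix.transpose_smul, aux_sym W' R' hs]

/-- Theorem 3.2, sufficiency part. Let `P ≥ 1`, let `W₁,…,W_{2P} ∈ ℝ^{d×d}`
be symmetric and `R₀,…,R_P ∈ ℝ^{d×N}` satisfy equation (WX):
`Σ_{i=0}^{P} W_{P+p−i} R_i = 0` for `p ∈ {1,…,P}`. Define `A₀,…,A_P` by equation (A_WX):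
`A₀ = R₀` and `A_p = R_p + i Σ_{j=1}^{p} W_j R_{p−j}`, and set `X(t) = Σ_{p=0}^{P} A_p t^p`.
Then the Gramian `X(t)ᴴ X(t)` has real coefficients. -/
theorem stmt9 {d N P : ℕ} (hP : 1 ≤ P)
    (W : ℕ → Matrix (Fin d) (Fin d) ℝ)
    (R : ℕ → Matrix (Fin d) (Fin N) ℝ)
    (hWsymm : ∀ k ∈ Finset.Icc 1 (2 * P), (W k).IsSymm)
    (hWX : ∀ p ∈ Finset.Icc 1 P, ∑ i ∈ Finset.range (P + 1), W (P + p - i) * R i = 0)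
    (A : ℕ → Matrix (Fin d) (Fin N) ℂ)
    (hA0 : A 0 = (R 0).map Complex.ofReal)
    (hAp : ∀ p ∈ Finset.Icc 1 P, A p = (R p).map Complex.ofReal +
      Complex.I • (∑ j ∈ Finset.Icc 1 p, W j * R (p - j)).map Complex.ofReal) :
    ∀ t : ℝ, ∀ i j, (((polyEvalC P A t)ᴴ * polyEvalC P A t) i j).im = 0 := by
  intro t i j
  set X := ∑ p ∈ range (P + 1), t ^ p • R p with hX
  set Y := ∑ p ∈ range (P + 1), t ^ p • ∑ j ∈ Finset.Icc 1 p, W j * R (p - j) with hY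
  have hsym : (Xᵀ * Y).IsSymm := aux_real W R hWsymm hWX t
  have hAall : ∀ p ∈ range (P + 1), A p = (R p).map Complex.ofReal +
      Complex.I • (∑ j ∈ Finset.Icc 1 p, W j * R (p - j)).map Complex.ofReal := by
    intro p hp
    rcases Nat.eq_zero_or_pos p with rfl | h
    · rw [hA0]; ext a b; simp
    · exact hAp p (by simp at hp ⊢; omega)
  have hE : ∀ a b, polyEvalC P A t a b = (X a b : ℂ) + Complex.I * (Y a b : ℂ) := by
    intro a b
    rw [polyEvalC, Finset.sum_congr rfl fun p hp => by rw [hAall p hp], hX, hY]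
    simp only [Matrix.sum_apply, Matrix.smul_apply, Matrix.add_apply, Matrix.map_apply,
      smul_eq_mul, Complex.ofReal_sum, Complex.ofReal_mul, Complex.ofReal_pow]
    rw [Finset.mul_sum, ← Finset.sum_add_distrib]
    refine Finset.sum_congr rfl fun p _ => ?_
    ring
  have h := hsym.apply j i
  simp only [Matrix.mul_apply, Matrix.transpose_apply] at h
  simp only [Matrix.mul_apply, Matrix.conjTranspose_apply, hE, Complex.im_sum]
  have : ∀ x, (star ((X x i : ℂ) + Complex.I * (Y x i : ℂ)) *
      ((X x j : ℂ) + Complex.I * (Y x j : ℂ))).im = X x i * Y x j - X x j * Y x i := by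
    intro x
    simp
    ring
  rw [Finset.sum_congr rfl fun x _ => this x, Finset.sum_sub_distrib]
  linarith
end

section
/- Let P ≥ 1 and let ({W_k}_{k=1}^{2P}, {R_p}_{p=0}^{P}) ∈ ℋ. Define A₀,…,A_P ∈ ℂ^{d×N} by equation (A_WX) and set X(t) = Σ_{p=0}^{P} A_p t^p and G(t) = X(t)ᴴ X(t). Then G has real coefficients, G(t) is symmetric positive semidefinite for every t ∈ ℝ, rank G(t) ≤ d for every t ∈ ℝ, and rank G(0) = d; in other words, G ∈ 𝒢. -/
open Matrix Finset

lemma aux_double {M : Type*} [AddCommMonoid M] (P : ℕ) (f : ℕ → ℕ → M)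
    (hf : ∀ a b, (P < a ∨ P < b) → f a b = 0) :
    ∑ k ∈ Finset.range (2 * P + 1), ∑ x ∈ Finset.HasAntidiagonal.antidiagonal k, f x.1 x.2 =
      ∑ a ∈ Finset.range (P + 1), ∑ b ∈ Finset.range (P + 1), f a b := by
  rw [← Finset.sum_product' (f := f)]
  rw [← Finset.sum_fiberwise_of_maps_to (s := Finset.range (P + 1) ×ˢ Finset.range (P + 1))
    (t := Finset.range (2 * P + 1)) (g := fun x => x.1 + x.2)]
  · refine Finset.sum_congr rfl fun k _ => ?_
    symm
    apply Finset.sum_subset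
    · intro x hx
      simp only [Finset.mem_filter, Finset.HasAntidiagonal.mem_antidiagonal] at hx ⊢
      exact hx.2
    · intro x hx hx'
      apply hf
      simp only [Finset.mem_filter, Finset.HasAntidiagonal.mem_antidiagonal, Finset.mem_product,
        Finset.mem_range] at hx hx'
      omega
  · intro x hx
    simp only [Finset.mem_product, Finset.mem_range] at hx ⊢
    omega

lemma aux_eval {d N : ℕ} (P : ℕ) (F G : ℕ → Matrix (Fin d) (Fin N) ℝ)
    (hF : ∀ a, P < a → F a = 0) (hG : ∀ a, P < a → G a = 0) (t : ℝ) :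
    ∑ k ∈ Finset.range (2 * P + 1), t ^ k • ∑ x ∈ Finset.HasAntidiagonal.antidiagonal k, (F x.1)ᵀ * G x.2 =
      (∑ a ∈ Finset.range (P + 1), t ^ a • F a)ᵀ * ∑ b ∈ Finset.range (P + 1), t ^ b • G b := by
  rw [Matrix.transpose_sum, Matrix.sum_mul]
  simp_rw [Matrix.mul_sum]
  rw [← aux_double P (fun a b => (t ^ a • F a)ᵀ * (t ^ b • G b))]
  · refine Finset.sum_congr rfl fun k _ => ?_
    rw [Finset.smul_sum]
    refine Finset.sum_congr rfl fun x hx => ?_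
    rw [Finset.HasAntidiagonal.mem_antidiagonal] at hx
    rw [Matrix.transpose_smul, Matrix.smul_mul, Matrix.mul_smul, smul_smul, ← pow_add, hx]
  · rintro a b (h | h)
    · simp [hF a h]
    · simp [hG b h]

lemma aux_symm {d N : ℕ} (P : ℕ) (W : ℕ → Matrix (Fin d) (Fin d) ℝ)
    (R S : ℕ → Matrix (Fin d) (Fin N) ℝ)
    (hW : ∀ k, (W k)ᵀ = W k)
    (hS : ∀ b, b ≤ 2 * P → S b = ∑ x ∈ Finset.HasAntidiagonal.antidiagonal b, W x.1 * R x.2)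
    (k : ℕ) (hk : k ≤ 2 * P) :
    ∑ x ∈ Finset.HasAntidiagonal.antidiagonal k, (R x.1)ᵀ * S x.2 =
      ∑ x ∈ Finset.HasAntidiagonal.antidiagonal k, (S x.1)ᵀ * R x.2 := by
  have h1 : ∑ x ∈ Finset.HasAntidiagonal.antidiagonal k, (R x.1)ᵀ * S x.2 =
      ∑ x ∈ Finset.HasAntidiagonal.antidiagonal k, ∑ y ∈ Finset.HasAntidiagonal.antidiagonal x.2,
        (R x.1)ᵀ * (W y.1 * R y.2) := by
    refine Finset.sum_congr rfl fun x hx => ?_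
    rw [Finset.HasAntidiagonal.mem_antidiagonal] at hx
    rw [hS _ (by omega), Matrix.mul_sum]
  have h2 : ∑ x ∈ Finset.HasAntidiagonal.antidiagonal k, (S x.1)ᵀ * R x.2 =
      ∑ x ∈ Finset.HasAntidiagonal.antidiagonal k, ∑ y ∈ Finset.HasAntidiagonal.antidiagonal x.1,
        (R y.1)ᵀ * (W y.2 * R x.2) := by
    refine Finset.sum_congr rfl fun x hx => ?_
    rw [Finset.HasAntidiagonal.mem_antidiagonal] at hx
    rw [hS _ (by omega), Matrix.transpose_sum, Matrix.sum_mul, ← Finset.Nat.sum_antidiagonal_swap]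
    refine Finset.sum_congr rfl fun y _ => ?_
    simp [Matrix.transpose_mul, hW, Matrix.mul_assoc]
  rw [h1, h2]
  rw [Finset.sum_sigma', Finset.sum_sigma']
  refine Finset.sum_nbij' (fun p => ⟨(p.1.1 + p.2.1, p.2.2), (p.1.1, p.2.1)⟩)
    (fun p => ⟨(p.2.1, p.2.2 + p.1.2), (p.2.2, p.1.2)⟩) ?_ ?_ ?_ ?_ ?_
  · rintro ⟨⟨a, b⟩, ⟨c, e⟩⟩ h
    simp only [Finset.mem_sigma, Finset.HasAntidiagonal.mem_antidiagonal] at h ⊢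
    grind
  · rintro ⟨⟨a, b⟩, ⟨c, e⟩⟩ h
    simp only [Finset.mem_sigma, Finset.HasAntidiagonal.mem_antidiagonal] at h ⊢
    grind
  · rintro ⟨⟨a, b⟩, ⟨c, e⟩⟩ h
    simp only [Finset.mem_sigma, Finset.HasAntidiagonal.mem_antidiagonal] at h
    obtain ⟨_, rfl⟩ := h
    rfl
  · rintro ⟨⟨a, b⟩, ⟨c, e⟩⟩ h
    simp only [Finset.mem_sigma, Finset.HasAntidiagonal.mem_antidiagonal] at h
    obtain ⟨_, rfl⟩ := h
    rfl
  · intro p _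
    rfl

lemma aux_conv {d N P : ℕ} (W : ℕ → Matrix (Fin d) (Fin d) ℝ)
    (R : ℕ → Matrix (Fin d) (Fin N) ℝ)
    (hWX : ∀ p ∈ Finset.Icc 1 P, ∑ i ∈ Finset.range (P + 1), W (P + p - i) * R i = 0)
    (b : ℕ) (hb : b ≤ 2 * P) :
    (if b ≤ P then ∑ j ∈ Finset.Icc 1 b, W j * R (b - j) else 0) =
      ∑ x ∈ Finset.HasAntidiagonal.antidiagonal b, (if 1 ≤ x.1 ∧ x.1 ≤ 2 * P then W x.1 else 0) *
        (if x.2 ≤ P then R x.2 else 0) := by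
  split_ifs with h
  · rw [Finset.Nat.sum_antidiagonal_eq_sum_range_succ
      (fun j c => (if 1 ≤ j ∧ j ≤ 2 * P then W j else 0) * (if c ≤ P then R c else 0))]
    rw [← Finset.sum_subset (s₁ := Finset.Icc 1 b) (s₂ := Finset.range b.succ)]
    · refine Finset.sum_congr rfl fun j hj => ?_
      rw [Finset.mem_Icc] at hj
      rw [if_pos (by omega), if_pos (by omega)]
    · intro j hj
      simp only [Finset.mem_Icc, Finset.mem_range] at *
      omega
    · intro j hj hj'
      simp only [Finset.mem_Icc, Finset.mem_range] at hj hj'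
      rw [if_neg (by omega), Matrix.zero_mul]
  · rw [← Finset.Nat.sum_antidiagonal_swap]
    simp only [Prod.fst_swap, Prod.snd_swap]
    rw [Finset.Nat.sum_antidiagonal_eq_sum_range_succ
      (fun c j => (if 1 ≤ j ∧ j ≤ 2 * P then W j else 0) * (if c ≤ P then R c else 0))]
    rw [← Finset.sum_subset (s₁ := Finset.range (P + 1))]
    · rw [← hWX (b - P) (by rw [Finset.mem_Icc]; omega)]
      refine Finset.sum_congr rfl fun j hj => ?_
      rw [Finset.mem_range] at hj
      rw [if_pos (by omega), if_pos (by omega), show P + (b - P) - j = b - j by omega]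
    · intro j hj
      simp only [Finset.mem_range] at *
      omega
    · intro j hj hj'
      simp only [Finset.mem_range] at *
      rw [if_neg (c := j ≤ P) (by omega), Matrix.mul_zero]

lemma aux_rank {d N : ℕ} (M : Matrix (Fin d) (Fin N) ℝ) (h : memX0 M) : (Mᵀ * M).rank = d := by
  rw [Matrix.rank_transpose_mul_self, ← Matrix.rank_self_mul_transpose]
  have : M * Mᵀ = Matrix.diagonal (fun i => M i ⬝ᵥ M i) := by
    ext i j
    rw [Matrix.mul_apply', Matrix.diagonal_apply]
    split_ifs with hij
    · subst hij; rfl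
    · exact h.1 i j hij
  rw [this, Matrix.rank_of_isUnit, Fintype.card_fin]
  rw [Matrix.isUnit_iff_isUnit_det, Matrix.det_diagonal, isUnit_iff_ne_zero, Finset.prod_ne_zero_iff]
  intro i _ h0
  obtain ⟨j, hj, _⟩ := h.2 i
  rw [dotProduct_self_eq_zero] at h0
  rw [h0] at hj
  simp at hj

lemma aux_map_rank {N : ℕ} (M : Matrix (Fin N) (Fin N) ℝ) :
    M.rank ≤ (M.map Complex.ofReal).rank := by
  obtain ⟨V, U, e, -, -, h⟩ := Matrix.exists_rank_normal_form M
  have h1 : ((V * M * U).map Complex.ofReal).submatrix (e.symm ∘ Sum.inl) (e.symm ∘ Sum.inl)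
      = (1 : Matrix (Fin M.rank) (Fin M.rank) ℂ) := by
    rw [h]
    ext i j
    simp only [Matrix.submatrix_apply, Matrix.map_apply, Function.comp, Equiv.apply_symm_apply,
      Matrix.fromBlocks_apply₁₁, Matrix.one_apply]
    split_ifs <;> simp
  have h2 : (V * M * U).map Complex.ofReal =
      V.map Complex.ofReal * M.map Complex.ofReal * U.map Complex.ofReal := by
    have h3 := Matrix.map_mul (L := V * M) (M := U) (f := Complex.ofRealHom)
    have h4 := Matrix.map_mul (L := V) (M := M) (f := Complex.ofRealHom)
    rw [h4] at h3
    exact h3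
  have h5 := Matrix.rank_submatrix_le ((V * M * U).map Complex.ofReal)
    (e.symm ∘ Sum.inl) (e.symm ∘ Sum.inl)
  rw [h1, Matrix.rank_one, Fintype.card_fin, h2] at h5
  exact h5.trans ((Matrix.rank_mul_le_left _ _).trans (Matrix.rank_mul_le_right _ _))

/-- Let `P ≥ 1` and `({W_k}, {R_p}) ∈ ℋ`, i.e. each `W_k` is symmetric,
`R₀ ∈ 𝒳₀`, and equation (WX) holds. Define `A₀,…,A_P` by equation (A_WX), set
`X(t) = Σ_{p=0}^{P} A_p t^p` and `G(t) = X(t)ᴴ X(t)`. Then `G ∈ 𝒢`: `G` has real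
coefficients `B₀,…,B_{2P}`, `G(t)` is symmetric positive semidefinite for every `t`,
`rank G(t) ≤ d` for every `t`, and `rank G(0) = d`. -/
theorem stmt10 {d N P : ℕ} (hP : 1 ≤ P)
    (W : ℕ → Matrix (Fin d) (Fin d) ℝ)
    (R : ℕ → Matrix (Fin d) (Fin N) ℝ)
    (hWsymm : ∀ k ∈ Finset.Icc 1 (2 * P), (W k).IsSymm)
    (hR0 : memX0 (R 0))
    (hWX : ∀ p ∈ Finset.Icc 1 P, ∑ i ∈ Finset.range (P + 1), W (P + p - i) * R i = 0)
    (A : ℕ → Matrix (Fin d) (Fin N) ℂ)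
    (hA0 : A 0 = (R 0).map Complex.ofReal)
    (hAp : ∀ p ∈ Finset.Icc 1 P, A p = (R p).map Complex.ofReal +
      Complex.I • (∑ j ∈ Finset.Icc 1 p, W j * R (p - j)).map Complex.ofReal) :
    ∃ B : ℕ → Matrix (Fin N) (Fin N) ℝ,
      (∀ t : ℝ, (polyEvalC P A t)ᴴ * polyEvalC P A t =
        (∑ k ∈ Finset.range (2 * P + 1), t ^ k • B k).map Complex.ofReal) ∧
      (∀ t : ℝ, (∑ k ∈ Finset.range (2 * P + 1), t ^ k • B k).PosSemidef) ∧
      (∀ t : ℝ, (∑ k ∈ Finset.range (2 * P + 1), t ^ k • B k).rank ≤ d) ∧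
      (∑ k ∈ Finset.range (2 * P + 1), (0 : ℝ) ^ k • B k).rank = d := by
  classical
  set R' : ℕ → Matrix (Fin d) (Fin N) ℝ := fun p => if p ≤ P then R p else 0 with hR'
  set S : ℕ → Matrix (Fin d) (Fin N) ℝ := fun b =>
    if b ≤ P then ∑ j ∈ Finset.Icc 1 b, W j * R (b - j) else 0 with hS
  have hR'0 : ∀ a, P < a → R' a = 0 := fun a ha => if_neg (by omega)
  have hS0 : ∀ a, P < a → S a = 0 := fun a ha => if_neg (by omega)
  have hsym := aux_symm P (fun j => if 1 ≤ j ∧ j ≤ 2 * P then W j else 0) R' S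
    (by
      intro k
      split_ifs with h
      · exact hWsymm k (by rw [Finset.mem_Icc]; exact h)
      · simp)
    (fun b hb => aux_conv W R hWX b hb)
  let Rt : ℝ → Matrix (Fin d) (Fin N) ℝ := fun t => ∑ a ∈ Finset.range (P + 1), t ^ a • R' a
  let St : ℝ → Matrix (Fin d) (Fin N) ℝ := fun t => ∑ a ∈ Finset.range (P + 1), t ^ a • S a
  have hRS : ∀ t, (Rt t)ᵀ * St t = (St t)ᵀ * Rt t := by
    intro t
    rw [← aux_eval P R' S hR'0 hS0 t, ← aux_eval P S R' hS0 hR'0 t]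
    refine Finset.sum_congr rfl fun k hk => ?_
    rw [hsym k (by rw [Finset.mem_range] at hk; omega)]
  let B : ℕ → Matrix (Fin N) (Fin N) ℝ := fun k =>
    ∑ x ∈ Finset.HasAntidiagonal.antidiagonal k, (R' x.1)ᵀ * R' x.2 + ∑ x ∈ Finset.HasAntidiagonal.antidiagonal k, (S x.1)ᵀ * S x.2
  have hB : ∀ t : ℝ, ∑ k ∈ Finset.range (2 * P + 1), t ^ k • B k =
      (Rt t)ᵀ * Rt t + (St t)ᵀ * St t := by
    intro t
    simp only [B, smul_add, Finset.sum_add_distrib]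
    rw [aux_eval P R' R' hR'0 hR'0 t, aux_eval P S S hS0 hS0 t]
  have hA : ∀ p ≤ P, A p = (R' p).map Complex.ofReal + Complex.I • (S p).map Complex.ofReal := by
    intro p hp
    rcases Nat.eq_zero_or_pos p with rfl | h
    · rw [hA0]
      ext i j
      simp [hR', hS]
    · rw [hAp p (by rw [Finset.mem_Icc]; omega)]
      simp only [hR', hS, if_pos hp]
  have hX : ∀ t, polyEvalC P A t =
      (Rt t).map Complex.ofReal + Complex.I • (St t).map Complex.ofReal := by
    intro t
    have : polyEvalC P A t = ∑ p ∈ Finset.range (P + 1), (t : ℂ) ^ p •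
        ((R' p).map Complex.ofReal + Complex.I • (S p).map Complex.ofReal) := by
      refine Finset.sum_congr rfl fun p hp => ?_
      rw [hA p (by rw [Finset.mem_range] at hp; omega)]
    rw [this]
    ext i j
    simp only [Rt, St, Matrix.sum_apply, Matrix.add_apply, Matrix.smul_apply, Matrix.map_apply,
      smul_eq_mul, Complex.ofReal_sum, Complex.ofReal_mul, Complex.ofReal_pow, Finset.mul_sum,
      ← Finset.sum_add_distrib]
    refine Finset.sum_congr rfl fun p _ => ?_
    ring
  have hG : ∀ t : ℝ, (polyEvalC P A t)ᴴ * polyEvalC P A t =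
        (∑ k ∈ Finset.range (2 * P + 1), t ^ k • B k).map Complex.ofReal := by
    intro t
    rw [hB, hX]
    ext i j
    have h := congrFun (congrFun (hRS t) i) j
    simp only [Matrix.mul_apply, Matrix.transpose_apply] at h
    have h' := congrArg Complex.ofReal h
    simp only [Complex.ofReal_sum, Complex.ofReal_mul] at h'
    simp only [Matrix.mul_apply, Matrix.add_apply, Matrix.map_apply, Matrix.transpose_apply,
      Matrix.conjTranspose_apply, Matrix.smul_apply, smul_eq_mul, star_add, star_mul',
      Complex.star_def, Complex.conj_ofReal, Complex.conj_I, Complex.ofReal_add,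
      Complex.ofReal_sum, Complex.ofReal_mul]
    have e : ∀ x, (((Rt t x i : ℝ) : ℂ) + -Complex.I * (St t x i : ℝ)) *
        ((Rt t x j : ℝ) + Complex.I * (St t x j : ℝ)) =
        ((Rt t x i : ℝ) : ℂ) * (Rt t x j : ℝ) + (St t x i : ℝ) * (St t x j : ℝ) +
        Complex.I * ((Rt t x i : ℝ) * (St t x j : ℝ)) -
        Complex.I * ((St t x i : ℝ) * (Rt t x j : ℝ)) := by
      intro x
      linear_combination (-((St t x i : ℝ) : ℂ) * (St t x j : ℝ)) * Complex.I_sq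
    simp_rw [e]
    rw [Finset.sum_sub_distrib, Finset.sum_add_distrib, Finset.sum_add_distrib,
      ← Finset.mul_sum, ← Finset.mul_sum, h']
    ring
  refine ⟨B, hG, ?_, ?_, ?_⟩
  · intro t
    rw [hB]
    have h1 := Matrix.posSemidef_conjTranspose_mul_self (Rt t)
    have h2 := Matrix.posSemidef_conjTranspose_mul_self (St t)
    rw [Matrix.conjTranspose_eq_transpose_of_trivial] at h1 h2
    exact h1.add h2
  · intro t
    refine (aux_map_rank _).trans ?_
    rw [← hG]
    refine (Matrix.rank_mul_le_right _ _).trans ?_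
    simpa using Matrix.rank_le_card_height (polyEvalC P A t)
  · rw [Finset.sum_range_succ', Finset.sum_eq_zero (fun k _ => by simp)]
    have : B 0 = (R 0)ᵀ * R 0 := by simp [B, hR', hS]
    rw [this]
    simpa using aux_rank (R 0) hR0
end

section
/- Let P ≥ 1. The map that sends a tuple ({W_k}_{k=1}^{2P}, {R_p}_{p=0}^{P}) ∈ ℋ to the coefficient tuple (A₀,…,A_P) defined by equation (A_WX) is a bijection from ℋ onto the set of tuples (A₀,…,A_P) of matrices in ℂ^{d×N} such that, writing A_p = R_p + i Q_p with R_p, Q_p real, one has Q₀ = 0, R₀ ∈ 𝒳₀, and the Gramian of X(t) = Σ_{p=0}^{P} A_p t^p has real coefficients. -/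
open Matrix Finset

/-- Extend a family `W₁, …, W_{2P}` (indexed by `Fin (2P)`, with `W_k = W ⟨k-1⟩`) to all of
`ℕ` by zero outside `{1, …, 2P}`. -/
def extW {d P : ℕ} (W : Fin (2 * P) → Matrix (Fin d) (Fin d) ℝ) :
    ℕ → Matrix (Fin d) (Fin d) ℝ :=
  fun k => if h : 1 ≤ k ∧ k ≤ 2 * P then W ⟨k - 1, by omega⟩ else 0

/-- Extend a family `R₀, …, R_P` (indexed by `Fin (P+1)`) to all of `ℕ` by zero. -/
def extR {d N P : ℕ} (R : Fin (P + 1) → Matrix (Fin d) (Fin N) ℝ) :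
    ℕ → Matrix (Fin d) (Fin N) ℝ :=
  fun p => if h : p ≤ P then R ⟨p, by omega⟩ else 0

/-- The set `ℋ` of tuples `({W_k}_{k=1}^{2P}, {R_p}_{p=0}^{P})` with each `W_k` symmetric,
`R₀ ∈ 𝒳₀`, satisfying equation (WX): `Σ_{i=0}^{P} W_{P+p−i} R_i = 0` for `p ∈ {1,…,P}`. -/
def Hset (d N P : ℕ) :
    Set ((Fin (2 * P) → Matrix (Fin d) (Fin d) ℝ) × (Fin (P + 1) → Matrix (Fin d) (Fin N) ℝ)) :=
  { WR | (∀ k, (WR.1 k).IsSymm) ∧ memX0 (WR.2 0) ∧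
    ∀ p ∈ Finset.Icc 1 P,
      ∑ i ∈ Finset.range (P + 1), extW WR.1 (P + p - i) * extR WR.2 i = 0 }

/-- The map of equation (A_WX): `A₀ = R₀` and `A_p = R_p + i Σ_{j=1}^{p} W_j R_{p−j}`. -/
noncomputable def phi {d N P : ℕ}
    (WR : (Fin (2 * P) → Matrix (Fin d) (Fin d) ℝ) × (Fin (P + 1) → Matrix (Fin d) (Fin N) ℝ)) :
    Fin (P + 1) → Matrix (Fin d) (Fin N) ℂ :=
  fun p => (extR WR.2 (p : ℕ)).map Complex.ofReal +
    Complex.I •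
      (∑ j ∈ Finset.Icc 1 (p : ℕ), extW WR.1 j * extR WR.2 ((p : ℕ) - j)).map Complex.ofReal

/-- The set of coefficient tuples `(A₀, …, A_P)` of complex polynomial matrices
`X(t) = Σ_{p=0}^{P} A_p t^p` such that, writing `A_p = R_p + i Q_p`, one has `Q₀ = 0`,
`R₀ ∈ 𝒳₀`, and the Gramian `X(t)ᴴ X(t)` has real coefficients. -/
def targetSet (d N P : ℕ) : Set (Fin (P + 1) → Matrix (Fin d) (Fin N) ℂ) :=
  { A | (∀ i j, (A 0 i j).im = 0) ∧ memX0 (Matrix.of fun i j => (A 0 i j).re) ∧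
    ∀ t : ℝ, ∀ i j,
      (((∑ p : Fin (P + 1), (t : ℂ) ^ (p : ℕ) • A p)ᴴ *
        ∑ p : Fin (P + 1), (t : ℂ) ^ (p : ℕ) • A p) i j).im = 0 }

/-- The power-series matrix with coefficients `extR F`. -/
noncomputable def serR {d N P : ℕ} (F : Fin (P + 1) → Matrix (Fin d) (Fin N) ℝ) :
    Matrix (Fin d) (Fin N) (PowerSeries ℝ) :=
  fun i j => PowerSeries.mk fun n => extR F n i j

/-- The power-series matrix with coefficients `extW W`. -/
noncomputable def serW {d P : ℕ} (W : Fin (2 * P) → Matrix (Fin d) (Fin d) ℝ) :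
    Matrix (Fin d) (Fin d) (PowerSeries ℝ) :=
  fun i j => PowerSeries.mk fun n => extW W n i j

/-- The polynomial matrix with coefficients `F`. -/
noncomputable def polR {d N P : ℕ} (F : Fin (P + 1) → Matrix (Fin d) (Fin N) ℝ) :
    Matrix (Fin d) (Fin N) (Polynomial ℝ) :=
  fun i j => ∑ p : Fin (P + 1), Polynomial.monomial (p : ℕ) (F p i j)

lemma extR_val {d N P : ℕ} (F : Fin (P + 1) → Matrix (Fin d) (Fin N) ℝ) (p : Fin (P + 1)) :
    extR F (p : ℕ) = F p := by
  have : (p : ℕ) ≤ P := by omega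
  simp [extR, this]

lemma polR_coe {d N P : ℕ} (F : Fin (P + 1) → Matrix (Fin d) (Fin N) ℝ) (i j) :
    ((polR F i j : Polynomial ℝ) : PowerSeries ℝ) = serR F i j := by
  ext n
  simp only [polR, serR, Polynomial.coeff_coe, Polynomial.finsetSum_coeff,
    Polynomial.coeff_monomial, PowerSeries.coeff_mk]
  by_cases h : n ≤ P
  · rw [Finset.sum_eq_single (⟨n, by omega⟩ : Fin (P + 1))]
    · simp [extR, h]
    · intro b _ hb
      rw [if_neg]
      intro h2
      apply hb
      ext
      exact h2
    · simp
  · rw [Finset.sum_eq_zero]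
    · simp [extR, h]
    · intro b _
      rw [if_neg]
      omega

/-- Imaginary part of the Gramian entry as a polynomial. -/
noncomputable def gramPol {d N P : ℕ} (R Q : Fin (P + 1) → Matrix (Fin d) (Fin N) ℝ)
    (i j : Fin N) : Polynomial ℝ :=
  ∑ l, (polR R l i * polR Q l j - polR Q l i * polR R l j)

lemma polR_eval {d N P : ℕ} (F : Fin (P + 1) → Matrix (Fin d) (Fin N) ℝ) (i j) (t : ℝ) :
    (polR F i j).eval t = ∑ p : Fin (P + 1), t ^ (p : ℕ) * F p i j := by
  simp [polR, Polynomial.eval_finsetSum, mul_comm]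

lemma gram_im {d N P : ℕ} (A : Fin (P + 1) → Matrix (Fin d) (Fin N) ℂ) (t : ℝ) (i j : Fin N) :
    (((∑ p : Fin (P + 1), (t : ℂ) ^ (p : ℕ) • A p)ᴴ *
        ∑ p : Fin (P + 1), (t : ℂ) ^ (p : ℕ) • A p) i j).im =
    (gramPol (fun p => (A p).map Complex.re) (fun p => (A p).map Complex.im) i j).eval t := by
  simp only [gramPol, Matrix.mul_apply, Complex.im_sum, Polynomial.eval_finsetSum,
    Polynomial.eval_sub, Polynomial.eval_mul, polR_eval]
  refine Finset.sum_congr rfl fun l _ => ?_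
  simp only [Matrix.conjTranspose_apply, Matrix.sum_apply, Matrix.smul_apply, Complex.mul_im,
    Complex.star_def, Complex.conj_re, Complex.conj_im, Complex.re_sum, Complex.im_sum,
    smul_eq_mul, ← Complex.ofReal_pow, Complex.mul_re, Complex.ofReal_re, Complex.ofReal_im,
    Matrix.map_apply, zero_mul, sub_zero, add_zero]
  ring

lemma gramPol_coe {d N P : ℕ} (R Q : Fin (P + 1) → Matrix (Fin d) (Fin N) ℝ) (i j : Fin N) :
    ((gramPol R Q i j : Polynomial ℝ) : PowerSeries ℝ) =
      ((serR R)ᵀ * serR Q - (serR Q)ᵀ * serR R) i j := by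
  rw [gramPol, ← Polynomial.coeToPowerSeries.ringHom_apply, map_sum]
  simp only [map_sub, map_mul, Polynomial.coeToPowerSeries.ringHom_apply, polR_coe,
    Matrix.sub_apply, Matrix.mul_apply, Matrix.transpose_apply, Finset.sum_sub_distrib]

lemma polR_natDegree {d N P : ℕ} (F : Fin (P + 1) → Matrix (Fin d) (Fin N) ℝ) (i j) :
    (polR F i j).natDegree ≤ P := by
  refine Polynomial.natDegree_sum_le_of_forall_le _ _ fun p _ => ?_
  exact (Polynomial.natDegree_monomial_le _).trans (by omega)

lemma gramPol_natDegree {d N P : ℕ} (R Q : Fin (P + 1) → Matrix (Fin d) (Fin N) ℝ)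
    (i j : Fin N) : (gramPol R Q i j).natDegree ≤ 2 * P := by
  refine Polynomial.natDegree_sum_le_of_forall_le _ _ fun l _ => ?_
  refine (Polynomial.natDegree_sub_le _ _).trans (max_le ?_ ?_) <;>
  · refine Polynomial.natDegree_mul_le.trans ?_
    rw [two_mul]
    exact add_le_add (polR_natDegree _ _ _) (polR_natDegree _ _ _)

lemma gram_iff {d N P : ℕ} (A : Fin (P + 1) → Matrix (Fin d) (Fin N) ℂ) :
    (∀ t : ℝ, ∀ i j,
      (((∑ p : Fin (P + 1), (t : ℂ) ^ (p : ℕ) • A p)ᴴ *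
        ∑ p : Fin (P + 1), (t : ℂ) ^ (p : ℕ) • A p) i j).im = 0) ↔
    ∀ i j, gramPol (fun p => (A p).map Complex.re) (fun p => (A p).map Complex.im) i j = 0 := by
  simp only [gram_im]
  constructor
  · intro h i j
    exact Polynomial.funext fun t => by rw [h t i j]; simp
  · intro h t i j
    rw [h]; simp

/-- Convolution. -/
noncomputable def conv {d N P : ℕ} (W : Fin (2 * P) → Matrix (Fin d) (Fin d) ℝ)
    (R : Fin (P + 1) → Matrix (Fin d) (Fin N) ℝ) (n : ℕ) : Matrix (Fin d) (Fin N) ℝ :=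
  ∑ j ∈ Finset.range (n + 1), extW W j * extR R (n - j)

lemma coeff_ser {d N P : ℕ} (W : Fin (2 * P) → Matrix (Fin d) (Fin d) ℝ)
    (R : Fin (P + 1) → Matrix (Fin d) (Fin N) ℝ) (n : ℕ) (i j) :
    PowerSeries.coeff n ((serW W * serR R) i j) = conv W R n i j := by
  simp only [conv, Matrix.mul_apply, map_sum, PowerSeries.coeff_mul, Matrix.sum_apply,
    Finset.Nat.sum_antidiagonal_eq_sum_range_succ_mk, serW, serR, PowerSeries.coeff_mk]
  rw [Finset.sum_comm]

lemma extW_zero {d P : ℕ} (W : Fin (2 * P) → Matrix (Fin d) (Fin d) ℝ) : extW W 0 = 0 := by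
  simp [extW]

lemma conv_low {d N P : ℕ} (W : Fin (2 * P) → Matrix (Fin d) (Fin d) ℝ)
    (R : Fin (P + 1) → Matrix (Fin d) (Fin N) ℝ) (n : ℕ) :
    conv W R n = ∑ j ∈ Finset.Icc 1 n, extW W j * extR R (n - j) := by
  symm
  refine Finset.sum_subset (fun x hx => ?_) fun x hx hx2 => ?_
  · simp at hx ⊢; omega
  · have : x = 0 := by simp at hx hx2; omega
    rw [this, extW_zero, Matrix.zero_mul]

lemma conv_high {d N P : ℕ} (W : Fin (2 * P) → Matrix (Fin d) (Fin d) ℝ)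
    (R : Fin (P + 1) → Matrix (Fin d) (Fin N) ℝ) (n : ℕ) (hn : P ≤ n) :
    conv W R n = ∑ i ∈ Finset.range (P + 1), extW W (n - i) * extR R i := by
  rw [conv, ← Finset.sum_range_reflect]
  symm
  refine (Finset.sum_subset (s₂ := Finset.range (n + 1)) (fun x hx => ?_) fun x hx hx2 => ?_).trans
    (Finset.sum_congr rfl fun x hx => ?_)
  · simp at hx ⊢; omega
  · have : ¬ x ≤ P := by simp at hx2; omega
    simp [extR, this]
  · have : x ≤ n := by simp at hx; omega
    rw [show n + 1 - 1 - x = n - x by omega, show n - (n - x) = x by omega]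

lemma phi_re {d N P : ℕ} (W : Fin (2 * P) → Matrix (Fin d) (Fin d) ℝ)
    (R : Fin (P + 1) → Matrix (Fin d) (Fin N) ℝ) (p i j) : (phi (W, R) p i j).re = R p i j := by
  simp [phi, extR_val]

lemma phi_im {d N P : ℕ} (W : Fin (2 * P) → Matrix (Fin d) (Fin d) ℝ)
    (R : Fin (P + 1) → Matrix (Fin d) (Fin N) ℝ) (p i j) :
    (phi (W, R) p i j).im = conv W R p i j := by
  simp [phi, conv_low]

lemma key_iff {d N P : ℕ} (W : Fin (2 * P) → Matrix (Fin d) (Fin d) ℝ)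
    (R : Fin (P + 1) → Matrix (Fin d) (Fin N) ℝ) (A : Fin (P + 1) → Matrix (Fin d) (Fin N) ℂ) :
    ((W, R) ∈ Hset d N P ∧ phi (W, R) = A) ↔
    (∀ k, (W k).IsSymm) ∧ memX0 (R 0) ∧ R = (fun p => (A p).map Complex.re) ∧
      ∀ n ≤ 2 * P, conv W R n = extR (fun p => (A p).map Complex.im) n := by
  constructor
  · rintro ⟨⟨h1, h2, h3⟩, rfl⟩
    refine ⟨h1, h2, ?_, ?_⟩
    · ext p i j
      simp [phi_re]
    · intro n hn
      by_cases h : n ≤ P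
      · ext i j
        simp [extR, h, phi_im]
      · have := h3 (n - P) (by simp; omega)
        rw [show P + (n - P) = n by omega] at this
        rw [conv_high _ _ _ (by omega)]
        simp only [extR, h, dite_false]
        exact this
  · rintro ⟨h1, h2, h3, h4⟩
    refine ⟨⟨h1, h2, ?_⟩, ?_⟩
    · intro p hp
      simp only [Finset.mem_Icc] at hp
      have := h4 (P + p) (by omega)
      rw [conv_high _ _ _ (by omega)] at this
      refine this.trans ?_
      simp only [extR]
      rw [dif_neg (by omega)]
    · ext p i j
      apply Complex.ext
      · rw [phi_re, h3]; rfl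
      · rw [phi_im, h4 p (by omega), extR_val]; rfl

lemma right_inv {d N : ℕ} {M : Matrix (Fin d) (Fin N) ℝ} (h : memX0 M) :
    ∃ B : Matrix (Fin N) (Fin d) ℝ, M * B = 1 := by
  refine ⟨Mᵀ * Matrix.diagonal (fun i => (M i ⬝ᵥ M i)⁻¹), ?_⟩
  have h1 : M * Mᵀ = Matrix.diagonal (fun i => M i ⬝ᵥ M i) := by
    ext i j
    by_cases hij : i = j
    · subst hij
      simp [Matrix.mul_apply, dotProduct]
    · rw [Matrix.diagonal_apply_ne _ hij, ← h.1 i j hij]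
      simp [Matrix.mul_apply, dotProduct]
  rw [← Matrix.mul_assoc, h1, Matrix.diagonal_mul_diagonal, ← Matrix.diagonal_one]
  congr 1
  ext i
  apply mul_inv_cancel₀
  obtain ⟨j, hj, _⟩ := h.2 i
  intro h0
  rw [dotProduct_self_eq_zero] at h0
  rw [h0] at hj
  simp at hj

lemma extW_symm {d P : ℕ} (W : Fin (2 * P) → Matrix (Fin d) (Fin d) ℝ)
    (h : ∀ k, (W k).IsSymm) (n : ℕ) : (extW W n).IsSymm := by
  unfold extW
  split_ifs
  · exact h _
  · exact Matrix.isSymm_zero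

lemma maps {d N P : ℕ} {W : Fin (2 * P) → Matrix (Fin d) (Fin d) ℝ}
    {R Q : Fin (P + 1) → Matrix (Fin d) (Fin N) ℝ} (hW : ∀ k, (W k).IsSymm)
    (h : ∀ n ≤ 2 * P, conv W R n = extR Q n) (i j) : gramPol R Q i j = 0 := by
  ext n
  rw [Polynomial.coeff_zero]
  by_cases hn : n ≤ 2 * P
  swap
  · exact Polynomial.coeff_eq_zero_of_natDegree_lt
      (lt_of_le_of_lt (gramPol_natDegree R Q i j) (by omega))
  rw [← Polynomial.coeff_coe, gramPol_coe]
  set E := serR Q - serW W * serR R with hE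
  have hdvd : ∀ i j, (PowerSeries.X : PowerSeries ℝ) ^ (2 * P + 1) ∣ E i j := by
    intro i j
    rw [PowerSeries.X_pow_dvd_iff]
    intro m hm
    rw [hE, Matrix.sub_apply, map_sub, coeff_ser, h m (by omega)]
    simp [serR]
  have hWs : (serW W)ᵀ = serW W := by
    ext a b n
    simp only [Matrix.transpose_apply, serW, PowerSeries.coeff_mk]
    exact (extW_symm W hW n).apply _ _
  have hQ : serR Q = E + serW W * serR R := by rw [hE]; abel
  have : (serR R)ᵀ * serR Q - (serR Q)ᵀ * serR R = (serR R)ᵀ * E - Eᵀ * serR R := by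
    rw [hQ, Matrix.transpose_add, Matrix.transpose_mul, hWs, Matrix.mul_add, Matrix.add_mul,
      Matrix.mul_assoc]
    abel
  rw [this]
  have hd : (PowerSeries.X : PowerSeries ℝ) ^ (2 * P + 1) ∣
      ((serR R)ᵀ * E - Eᵀ * serR R) i j := by
    rw [Matrix.sub_apply, Matrix.mul_apply, Matrix.mul_apply]
    refine dvd_sub (Finset.dvd_sum fun l _ => ?_) (Finset.dvd_sum fun l _ => ?_)
    · exact Dvd.dvd.mul_left (hdvd _ _) _
    · exact Dvd.dvd.mul_right (hdvd _ _) _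
  exact PowerSeries.X_pow_dvd_iff.1 hd n (by omega)

lemma inj {d N P : ℕ} {W W' : Fin (2 * P) → Matrix (Fin d) (Fin d) ℝ}
    {R : Fin (P + 1) → Matrix (Fin d) (Fin N) ℝ} (hR : memX0 (R 0))
    (h : ∀ n ≤ 2 * P, conv W R n = conv W' R n) : W = W' := by
  obtain ⟨B, hB⟩ := right_inv hR
  have h0 : extR R 0 = R 0 := extR_val R 0
  have key : ∀ n ≤ 2 * P, extW W n = extW W' n := by
    intro n
    induction n using Nat.strong_induction_on with
    | _ n ih =>
      intro hn
      have h1 := h n hn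
      rw [conv, conv, Finset.sum_range_succ, Finset.sum_range_succ, Nat.sub_self, h0,
        Finset.sum_congr rfl (fun j hj => by
          rw [ih j (Finset.mem_range.1 hj) (by have := Finset.mem_range.1 hj; omega)])] at h1
      have h2 := congrArg (· * B) (add_left_cancel h1)
      simpa [Matrix.mul_assoc, hB] using h2
  ext k : 1
  have := key (k + 1) (by omega)
  have hk : (k : ℕ) + 1 ≤ 2 * P := by omega
  simpa [extW, hk] using this

lemma surj {d N P : ℕ} {R Q : Fin (P + 1) → Matrix (Fin d) (Fin N) ℝ} (hR : memX0 (R 0))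
    (hQ : Q 0 = 0) (h : ∀ i j, gramPol R Q i j = 0) :
    ∃ W : Fin (2 * P) → Matrix (Fin d) (Fin d) ℝ, (∀ k, (W k).IsSymm) ∧
      ∀ n ≤ 2 * P, conv W R n = extR Q n := by
  obtain ⟨B, hB⟩ := right_inv hR
  have hs : (serR R)ᵀ * serR Q = (serR Q)ᵀ * serR R := by
    rw [← sub_eq_zero]
    ext1 i j
    rw [← gramPol_coe, h]
    simp
  set Bs : Matrix (Fin N) (Fin d) (PowerSeries ℝ) := B.map (PowerSeries.C (R := ℝ)) with hBs
  set U := serR R * Bs with hU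
  set V := serR Q * Bs with hV
  have hU0 : U.map (PowerSeries.constantCoeff (R := ℝ)) = 1 := by
    rw [hU, Matrix.map_mul, ← hB]
    have e1 : (serR R).map (PowerSeries.constantCoeff (R := ℝ)) = R 0 := by
      ext i j
      simp [serR, extR]
    have e2 : Bs.map (PowerSeries.constantCoeff (R := ℝ)) = B := by
      ext i j
      simp [hBs]
    rw [e1, e2]
  have hV0 : V.map (PowerSeries.constantCoeff (R := ℝ)) = 0 := by
    rw [hV, Matrix.map_mul]
    have : (serR Q).map (PowerSeries.constantCoeff (R := ℝ)) = 0 := by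
      ext i j
      simp [serR, extR, hQ]
    rw [this, Matrix.zero_mul]
  have hdet : IsUnit U.det := by
    rw [PowerSeries.isUnit_iff_constantCoeff, RingHom.map_det, RingHom.mapMatrix_apply, hU0]
    simp
  have hUi : U * U⁻¹ = 1 := Matrix.mul_nonsing_inv _ hdet
  have hUi' : (U⁻¹)ᵀ * Uᵀ = 1 := by rw [← Matrix.transpose_mul, hUi, Matrix.transpose_one]
  set S := V * U⁻¹ with hS
  have e1 : Uᵀ * serR Q = Vᵀ * serR R := by
    rw [hU, hV, Matrix.transpose_mul, Matrix.transpose_mul, Matrix.mul_assoc, hs,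
      Matrix.mul_assoc]
  have e2 : Uᵀ * V = Vᵀ * U := by
    rw [hV, ← Matrix.mul_assoc, e1, Matrix.mul_assoc, ← hU, ← hV]
  have e3 : Sᵀ = S := by
    calc Sᵀ = (U⁻¹)ᵀ * (Vᵀ * U) * U⁻¹ := by
            rw [hS, Matrix.transpose_mul, Matrix.mul_assoc, Matrix.mul_assoc, hUi, Matrix.mul_one]
      _ = S := by rw [← e2, ← Matrix.mul_assoc, hUi', Matrix.one_mul]
  have e4 : S * serR R = serR Q := by
    rw [← e3, hS, Matrix.transpose_mul, Matrix.mul_assoc, ← e1, ← Matrix.mul_assoc, hUi',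
      Matrix.one_mul]
  have hS0 : S.map (PowerSeries.constantCoeff (R := ℝ)) = 0 := by
    rw [hS, Matrix.map_mul, hV0, Matrix.zero_mul]
  refine ⟨fun k => Matrix.of fun i j => PowerSeries.coeff ((k : ℕ) + 1) (S i j), ?_, ?_⟩
  · intro k
    ext i j
    simp only [Matrix.transpose_apply, Matrix.of_apply]
    conv_rhs => rw [← e3]
    rfl
  · intro n hn
    have hW : ∀ m ≤ 2 * P, ∀ i j, extW (fun k : Fin (2 * P) => (Matrix.of fun i j =>
        PowerSeries.coeff ((k : ℕ) + 1) (S i j) : Matrix (Fin d) (Fin d) ℝ)) m i j =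
        PowerSeries.coeff m (S i j) := by
      intro m hm i j
      rcases m with _ | m
      · rw [extW_zero]
        have := congrFun (congrFun hS0 i) j
        simpa using this.symm
      · simp [extW, hm]
    ext i j
    have e5 := congrArg (PowerSeries.coeff n) (congrFun (congrFun e4 i) j)
    simp only [Matrix.mul_apply, map_sum, PowerSeries.coeff_mul,
      Finset.Nat.sum_antidiagonal_eq_sum_range_succ_mk, serR, PowerSeries.coeff_mk] at e5
    rw [← e5, Finset.sum_comm, _root_.conv, Matrix.sum_apply]
    refine Finset.sum_congr rfl fun m hm => ?_
    rw [Matrix.mul_apply]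
    refine Finset.sum_congr rfl fun l _ => ?_
    rw [hW m (by simp at hm; omega)]

/-- Theorem 3.2, bijectivity part. The map sending
`({W_k}_{k=1}^{2P}, {R_p}_{p=0}^{P}) ∈ ℋ` to the coefficient tuple `(A₀,…,A_P)` of equation
(A_WX) is a bijection from `ℋ` onto the set of tuples `(A₀,…,A_P)` with `Q₀ = 0`,
`R₀ ∈ 𝒳₀`, whose Gramian has real coefficients. -/
theorem stmt11 {d N P : ℕ} (hP : 1 ≤ P) :
    Set.BijOn phi (Hset d N P) (targetSet d N P) := by
  refine ⟨?_, ?_, ?_⟩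
  · rintro ⟨W, R⟩ hWR
    obtain ⟨h1, h2, h3, h4⟩ := (key_iff W R _).1 ⟨hWR, rfl⟩
    refine ⟨fun i j => ?_, ?_, ?_⟩
    · rw [phi_im, conv_low]; simp
    · convert h2 using 1
      ext i j
      simp [phi_re]
    · rw [gram_iff, ← h3]
      exact maps h1 h4
  · rintro ⟨W, R⟩ hWR ⟨W', R'⟩ hWR' heq
    obtain ⟨h1, h2, h3, h4⟩ := (key_iff W R _).1 ⟨hWR, heq⟩
    obtain ⟨h1', h2', h3', h4'⟩ := (key_iff W' R' _).1 ⟨hWR', rfl⟩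
    have hRR : R = R' := h3.trans h3'.symm
    subst hRR
    rw [inj h2 fun n hn => (h4 n hn).trans (h4' n hn).symm]
  · rintro A ⟨h1, h2, h3⟩
    rw [gram_iff] at h3
    have hQ0 : (fun p => (A p).map Complex.im) 0 = 0 := by
      ext i j
      simp [h1]
    obtain ⟨W, hW, hc⟩ := surj (R := fun p => (A p).map Complex.re)
      (Q := fun p => (A p).map Complex.im) h2 hQ0 h3
    exact ⟨(W, _), (key_iff W _ A).2 ⟨hW, h2, rfl, hc⟩⟩
end

section
/- Let P ≥ 1 and let X(t) = Σ_{p=0}^{P} A_p t^p with A_p ∈ ℂ^{d×N}, where the constant coefficient A₀ is real with rank A₀ = d. Suppose the Gramian G(t) = X(t)ᴴ X(t) admits a real spectral factor, i.e. there exists Y(t) = Σ_{p=0}^{P} C_p t^p with C_p ∈ ℝ^{d×N} and G(t) = Y(t)ᵀ Y(t) for all t ∈ ℝ. Then, assuming every two spectral factors of G are related by a constant unitary matrix, all coefficients A₀,…,A_P of X are real. -/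
open Matrix Finset

/-- Evaluation at `t ∈ ℝ` of the real polynomial matrix with coefficients `C_0, …, C_P`. -/
noncomputable def polyEvalR {d N : ℕ} (P : ℕ) (C : ℕ → Matrix (Fin d) (Fin N) ℝ) (t : ℝ) :
    Matrix (Fin d) (Fin N) ℝ :=
  ∑ p ∈ Finset.range (P + 1), t ^ p • C p

/-- used in the proof of Lemma 3.3. Let `P ≥ 1` and
`X(t) = Σ_{p=0}^{P} A_p t^p` with `A₀` real of rank `d`. Suppose the Gramian
`G(t) = X(t)ᴴ X(t)` admits a real spectral factor `Y(t) = Σ_{p=0}^{P} C_p t^p` with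
`G(t) = Y(t)ᵀ Y(t)` for all `t`. Then, assuming every two (complex polynomial) spectral
factors of `G` are related by a constant unitary matrix, all coefficients `A₀, …, A_P` of
`X` are real. -/
theorem stmt13 {d N P : ℕ} (hP : 1 ≤ P)
    (A : ℕ → Matrix (Fin d) (Fin N) ℂ)
    (R0 : Matrix (Fin d) (Fin N) ℝ)
    (hA0 : A 0 = R0.map Complex.ofReal) (hR0 : R0.rank = d)
    (hUniq : ∀ (P₁ P₂ : ℕ) (B₁ B₂ : ℕ → Matrix (Fin d) (Fin N) ℂ),
      (∀ t : ℝ, (polyEvalC P₁ B₁ t)ᴴ * polyEvalC P₁ B₁ t =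
        (polyEvalC P A t)ᴴ * polyEvalC P A t) →
      (∀ t : ℝ, (polyEvalC P₂ B₂ t)ᴴ * polyEvalC P₂ B₂ t =
        (polyEvalC P A t)ᴴ * polyEvalC P A t) →
      ∃ U : Matrix (Fin d) (Fin d) ℂ, U ∈ Matrix.unitaryGroup (Fin d) ℂ ∧
        ∀ t : ℝ, polyEvalC P₂ B₂ t = U * polyEvalC P₁ B₁ t)
    (C : ℕ → Matrix (Fin d) (Fin N) ℝ)
    (hfactor : ∀ t : ℝ, (polyEvalC P A t)ᴴ * polyEvalC P A t =
      ((polyEvalR P C t)ᵀ * polyEvalR P C t).map Complex.ofReal) :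
    ∀ p ≤ P, ∀ i j, (A p i j).im = 0 := by
  have hev : ∀ t : ℝ, polyEvalC P (fun p => (A p).map (starRingEnd ℂ)) t =
      (polyEvalC P A t).map (starRingEnd ℂ) := by
    intro t
    ext i j
    simp [polyEvalC, Matrix.sum_apply]
  obtain ⟨U, -, hU⟩ := hUniq P P A (fun p => (A p).map (starRingEnd ℂ)) (fun _ => rfl) (by
    intro t
    have h1 : (polyEvalC P (fun p => (A p).map (starRingEnd ℂ)) t)ᴴ *
        polyEvalC P (fun p => (A p).map (starRingEnd ℂ)) t =
        ((polyEvalC P A t)ᴴ * polyEvalC P A t).map (starRingEnd ℂ) := by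
      rw [hev, Matrix.map_mul]
      congr 1
    rw [h1, hfactor]
    ext i j
    simp only [Matrix.map_apply, Complex.conj_ofReal])
  have hsurj : Function.Surjective R0.mulVec := by
    have : LinearMap.range R0.mulVecLin = ⊤ := by
      apply Submodule.eq_top_of_finrank_eq
      rw [← Matrix.rank, hR0]
      simp
    exact LinearMap.range_eq_top.mp this
  obtain ⟨S, hS⟩ := Matrix.mulVec_surjective_iff_exists_right_inverse.mp hsurj
  have hAS : A 0 * S.map Complex.ofReal = 1 := by
    have h2 := congrArg (fun M => M.map Complex.ofRealHom) hS
    simp only [Matrix.map_mul] at h2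
    rw [hA0]
    refine Eq.trans h2 ?_
    ext i j
    by_cases h : i = j <;> simp [h, Matrix.one_apply]
  have h0 : polyEvalC P A 0 = A 0 := by
    simp [polyEvalC, Finset.sum_range_succ']
  have hU1 : U = 1 := by
    have h3 := hU 0
    rw [hev, h0] at h3
    have h4 : (A 0).map (starRingEnd ℂ) = A 0 := by
      rw [hA0]; ext i j; simp
    rw [h4] at h3
    have h5 := congrArg (fun M => M * S.map Complex.ofReal) h3
    simp only [Matrix.mul_assoc, hAS, Matrix.mul_one] at h5
    exact h5.symm
  intro p hp i j
  have hq : (∑ k ∈ Finset.range (P + 1),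
      Polynomial.monomial k ((A k i j).im) : Polynomial ℝ) = 0 := by
    apply Polynomial.funext
    intro t
    have h6 := hU t
    rw [hU1, Matrix.one_mul, hev] at h6
    have h7 := congrFun (congrFun h6 i) j
    rw [Matrix.map_apply, Complex.conj_eq_iff_im] at h7
    rw [Polynomial.eval_finset_sum, Polynomial.eval_zero, ← h7]
    simp only [polyEvalC, Matrix.sum_apply, Matrix.smul_apply, Complex.im_sum, smul_eq_mul,
      Polynomial.eval_monomial, ← Complex.ofReal_pow, Complex.im_ofReal_mul]
    exact Finset.sum_congr rfl fun _ _ => mul_comm _ _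
  have h8 := congrArg (fun q => Polynomial.coeff q p) hq
  simpa [Polynomial.finset_sum_coeff, Polynomial.coeff_monomial, Nat.lt_succ_iff, hp] using h8
end
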